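/- For every positive integer r there is a positive integer f = f(r) with the following property. Let G be a graph and assume that there is a 2-ample linear induced (f,f)-model in G. Then G has an induced minor isomorphic to the r-by-r wall W_{r×r}. -/

import Mathlib

open SimpleGraph

/-- Two vertex sets `X` and `Y` are *anticomplete* in `G` if they are disjoint and
there is no edge of `G` with an end in each. -/
def Anticomplete {V : Type} (G : SimpleGraph V) (X Y : Set V) : Prop :=
  Disjoint X Y ∧ ∀ x ∈ X, ∀ y ∈ Y, ¬ G.Adj x y

/-- `G` has an induced subgraph isomorphic to `H`. -/
def HasInducedSubgraphIso {V W : Type} (G : SimpleGraph V) (H : SimpleGraph W) : Prop :=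
  ∃ X : Set V, Nonempty (H ≃g G.induce X)

/-- `G` has an induced minor isomorphic to `H`, witnessed by branch sets. -/
def HasInducedMinor {V W : Type} (G : SimpleGraph V) (H : SimpleGraph W) : Prop :=
  ∃ B : W → Set V,
    (∀ w, (G.induce (B w)).Connected) ∧
    (Pairwise fun u v => Disjoint (B u) (B v)) ∧
    (∀ u v : W, u ≠ v → (H.Adj u v ↔ ¬ Anticomplete G (B u) (B v)))

/-- The set `P` induces a path in `G`. -/
def IsPathSet {V : Type} (G : SimpleGraph V) (P : Set V) : Prop :=
  ∃ n : ℕ, Nonempty (G.induce P ≃g pathGraph (n + 1))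

/-- The vertex sets of the connected components of the subgraph of `G` induced on `X`. -/
def CompsOn {V : Type} (G : SimpleGraph V) (X : Set V) : Set (Set V) :=
  {L | ∃ C : (G.induce X).ConnectedComponent, L = Subtype.val '' C.supp}

/-- The induced subgraph of `G` on `W` together with the stable set `S ⊆ W` forms a
constellation: every component of `W \ S` is a path and every vertex of `S` has a
neighbor in every such component. -/
structure IsConstellationOn {V : Type} (G : SimpleGraph V) (W S : Set V) : Prop where
  subset : S ⊆ W
  stable : ∀ x ∈ S, ∀ y ∈ S, ¬ G.Adj x y
  comp_paths : ∀ L ∈ CompsOn G (W \ S), IsPathSet G L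
  dominates : ∀ x ∈ S, ∀ L ∈ CompsOn G (W \ S), ∃ y ∈ L, G.Adj x y

/-- `p` is a route of the constellation `(W, S)` in `G`: an induced path of the induced
subgraph of `G` on `W`, with its two (distinct) ends in `S` and its interior outside `S`. -/
structure IsRoute {V : Type} (G : SimpleGraph V) (W S : Set V) {x y : V}
    (p : G.Walk x y) : Prop where
  ne : x ≠ y
  isPath : p.IsPath
  induced : ∀ u v, u ∈ p.support → v ∈ p.support → G.Adj u v → p.toSubgraph.Adj u v
  support_mem : ∀ v ∈ p.support, v ∈ W
  fst_mem : x ∈ S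
  snd_mem : y ∈ S
  interior : ∀ v ∈ p.support, v ≠ x → v ≠ y → v ∉ S

/-- The constellation `(W, S)` in `G` is `d`-ample: no route has length at most `d+1`. -/
def DAmple {V : Type} (G : SimpleGraph V) (W S : Set V) (d : ℕ) : Prop :=
  ∀ ⦃x y : V⦄ (p : G.Walk x y), IsRoute G W S p → d + 1 < p.length

/-- The constellation `(W, S)` in `G` is interrupted with respect to some linear order
(encoded by an injective-on-`S` function `f : V → ℕ`). -/
def Interrupted {V : Type} (G : SimpleGraph V) (W S : Set V) : Prop :=
  ∃ f : V → ℕ, Set.InjOn f S ∧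
    ∀ x ∈ S, ∀ y ∈ S, ∀ z ∈ S, f x < f y → f y < f z →
      ∀ (p : G.Walk x y), IsRoute G W S p → ∃ v ∈ p.support, G.Adj z v

/-- The constellation `(W, S)` in `G` is `q`-zigzagged. -/
def Zigzagged {V : Type} (G : SimpleGraph V) (W S : Set V) (q : ℕ) : Prop :=
  ∃ f : V → ℕ, Set.InjOn f S ∧
    ∀ x ∈ S, ∀ y ∈ S, f x < f y →
      ∀ (p : G.Walk x y), IsRoute G W S p →
        {z | z ∈ S ∧ f x < f z ∧ f z < f y ∧ ¬ ∃ v ∈ p.support, G.Adj z v}.ncard < q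

/-- The constellation `(W, S)` in `G` is `(qm, q, qp)`-mixed. -/
def Mixed {V : Type} (G : SimpleGraph V) (W S : Set V) (qm q qp : ℕ) : Prop :=
  ∃ f : V → ℕ, Set.InjOn f S ∧
    ∀ x ∈ S, ∀ y ∈ S, f x < f y →
      ∀ (p : G.Walk x y), IsRoute G W S p →
        ∀ Qm Q Qp : Set V, Qm ⊆ S → Q ⊆ S → Qp ⊆ S →
          Qm.ncard = qm → Q.ncard = q → Qp.ncard = qp →
          (∀ z ∈ Qm, f z < f x) → (∀ z ∈ Q, f x < f z ∧ f z < f y) →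
          (∀ z ∈ Qp, f y < f z) →
          ∃ z ∈ Qm ∪ Q ∪ Qp, ∃ v ∈ p.support, G.Adj z v

/-- The constellation `(W', S')` sits in the constellation `(W, S)` (both within `G`). -/
def SitsIn {V : Type} (G : SimpleGraph V) (W' S' W S : Set V) : Prop :=
  W' ⊆ W ∧ S' ⊆ S ∧
  (∀ L ∈ CompsOn G (W' \ S'), ∃ M ∈ CompsOn G (W \ S), L ⊆ M) ∧
  (∀ M ∈ CompsOn G (W \ S), ∀ L₁ ∈ CompsOn G (W' \ S'), ∀ L₂ ∈ CompsOn G (W' \ S'),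
      L₁ ⊆ M → L₂ ⊆ M → L₁ = L₂)

/-- A witness that `S` is a subdivision of `H`, where each edge of `H` is replaced by a
path whose length satisfies `ok`. -/
structure SubdivModel {U W : Type} (S : SimpleGraph U) (H : SimpleGraph W)
    (ok : ℕ → Prop) where
  b : W → U
  b_inj : Function.Injective b
  path : ∀ ⦃u v : W⦄, H.Adj u v → S.Walk (b u) (b v)
  path_isPath : ∀ ⦃u v : W⦄ (h : H.Adj u v), (path h).IsPath
  path_len : ∀ ⦃u v : W⦄ (h : H.Adj u v), ok (path h).length
  path_symm : ∀ ⦃u v : W⦄ (h : H.Adj u v), path h.symm = (path h).reverse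
  branch_avoid : ∀ ⦃u v : W⦄ (h : H.Adj u v) (w : W), b w ∈ (path h).support → w = u ∨ w = v
  interiors_anticomplete :
    ∀ ⦃u v u' v' : W⦄ (h : H.Adj u v) (h' : H.Adj u' v'),
      (s(u, v) : Sym2 W) ≠ s(u', v') →
      ∀ x ∈ (path h).support, x ≠ b u → x ≠ b v →
      ∀ y ∈ (path h').support, y ≠ b u' → y ≠ b v' →
        x ≠ y ∧ ¬ S.Adj x y
  cover : ∀ x : U, (∃ w, x = b w) ∨ ∃ (u v : W) (h : H.Adj u v), x ∈ (path h).support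
  edges_eq : ∀ x y : U, S.Adj x y → ∃ (u v : W) (h : H.Adj u v), (path h).toSubgraph.Adj x y

/-- `S` is a subdivision of `H` with path lengths satisfying `ok`. -/
def IsSubdivisionWith {U W : Type} (S : SimpleGraph U) (H : SimpleGraph W)
    (ok : ℕ → Prop) : Prop :=
  Nonempty (SubdivModel S H ok)

/-- The line graph of `G`. -/
def LineGraph {V : Type} (G : SimpleGraph V) : SimpleGraph G.edgeSet :=
  SimpleGraph.fromRel (fun e f => ∃ v : V, v ∈ (e : Sym2 V) ∧ v ∈ (f : Sym2 V))

/-- The `r`-by-`r` hexagonal wall (brick wall). -/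
def Wall (r : ℕ) : SimpleGraph (Fin r × Fin (2 * r)) :=
  SimpleGraph.fromRel (fun a b =>
    (a.1 = b.1 ∧ a.2.val + 1 = b.2.val) ∨
    (a.2 = b.2 ∧ a.1.val + 1 = b.1.val ∧ (a.1.val + a.2.val) % 2 = 0))

/-- The full binary tree of radius `r`, on `2^(r+1) - 1` vertices (heap indexing). -/
def BinTree (r : ℕ) : SimpleGraph (Fin (2 ^ (r + 1) - 1)) :=
  SimpleGraph.fromRel (fun a b =>
    b.val + 1 = 2 * (a.val + 1) ∨ b.val + 1 = 2 * (a.val + 1) + 1)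

/-- The leaf-extension of `H` by leaves `L` attached via `f`. -/
def leafExt {W : Type} (H : SimpleGraph W) (L : Type) (f : L → W) :
    SimpleGraph (W ⊕ L) :=
  SimpleGraph.fromRel (fun a b =>
    match a, b with
    | Sum.inl a, Sum.inl b => H.Adj a b
    | Sum.inl a, Sum.inr x => f x = a
    | _, _ => False)

/-- `G` has treewidth at most `k` (via tree decompositions). -/
def TreewidthLE {V : Type} (G : SimpleGraph V) (k : ℕ) : Prop :=
  ∃ (ι : Type) (T : SimpleGraph ι) (bag : ι → Set V),
    T.IsTree ∧
    (∀ v, ∃ i, v ∈ bag i) ∧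
    (∀ u v, G.Adj u v → ∃ i, u ∈ bag i ∧ v ∈ bag i) ∧
    (∀ v, (T.induce {i | v ∈ bag i}).Connected) ∧
    (∀ i, (bag i).ncard ≤ k + 1)

/-- `G` has pathwidth at most `k` (via path decompositions). -/
def PathwidthLE {V : Type} (G : SimpleGraph V) (k : ℕ) : Prop :=
  ∃ (n : ℕ) (bag : Fin n → Set V),
    (∀ v, ∃ i, v ∈ bag i) ∧
    (∀ u v, G.Adj u v → ∃ i, u ∈ bag i ∧ v ∈ bag i) ∧
    (∀ (v : V) (i j k' : Fin n), i ≤ j → j ≤ k' → v ∈ bag i → v ∈ bag k' → v ∈ bag j) ∧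
    (∀ i, (bag i).ncard ≤ k + 1)

/-- An induced `(s,t)`-model in `G`. -/
def IsInducedModel {V : Type} (G : SimpleGraph V) {s t : ℕ}
    (A : Fin s → Set V) (B : Fin t → Set V) : Prop :=
  (∀ i, (G.induce (A i)).Connected) ∧
  (∀ j, (G.induce (B j)).Connected) ∧
  (∀ i j : Fin s, i ≠ j → Anticomplete G (A i) (A j)) ∧
  (∀ i j : Fin t, i ≠ j → Anticomplete G (B i) (B j)) ∧
  (∀ (i : Fin s) (j : Fin t), Disjoint (A i) (B j) ∧ ¬ Anticomplete G (A i) (B j))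

/-- The `A`-contraction of a model: each `A i` is contracted to the vertex `Sum.inl i`. -/
def AContraction {V : Type} (G : SimpleGraph V) {s t : ℕ}
    (A : Fin s → Set V) (B : Fin t → Set V) :
    SimpleGraph (Fin s ⊕ (⋃ j, B j : Set V)) :=
  SimpleGraph.fromRel (fun x y =>
    match x, y with
    | Sum.inl i, Sum.inl i' => i ≠ i' ∧ ∃ a ∈ A i, ∃ a' ∈ A i', G.Adj a a'
    | Sum.inl i, Sum.inr b => ∃ a ∈ A i, G.Adj a ↑b
    | Sum.inr b, Sum.inr b' => G.Adj ↑b ↑b'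
    | _, _ => False)

/-- A linear induced model is `d`-`A`-ample if its `A`-contraction is `d`-ample. -/
def ModelAAmple {V : Type} (G : SimpleGraph V) {s t : ℕ}
    (A : Fin s → Set V) (B : Fin t → Set V) (d : ℕ) : Prop :=
  DAmple (AContraction G A B) Set.univ (Set.range Sum.inl) d

/-- A linear induced model is `d`-ample if it is `d`-`A`-ample and `d`-`B`-ample. -/
def ModelAmple {V : Type} (G : SimpleGraph V) {s t : ℕ}
    (A : Fin s → Set V) (B : Fin t → Set V) (d : ℕ) : Prop :=
  ModelAAmple G A B d ∧ ModelAAmple G B A d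

/-- The zigzag sequences. -/
def Zseq : ℕ → List ℤ
  | 0 => []
  | 1 => [1]
  | 2 => [1, 2]
  | 3 => [1, 2, 3]
  | n + 4 =>
      (Zseq (n + 3)).dropLast ++ (((Zseq (n + 2)).map (· + 1)).reverse).dropLast
        ++ (Zseq (n + 3)).map (· + 1)

/-- Collapse each maximal run of consecutive equal entries to a single entry. -/
def collapse (l : List ℤ) : List ℤ := l.destutter (· ≠ ·)

/-- `B` is an alignment in the sequence `A`. -/
def IsAlignment (A : List ℤ) (B : Finset ℤ) : Prop :=
  (∀ b ∈ B, b ∈ A) ∧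
  ∃ i j : ℕ, i ≤ j ∧ j < A.length ∧
    ∀ b ∈ B,
      (collapse (((A.take (j + 1)).drop i).filter (fun a => decide (a ∈ B)))).count b = 1

/-- Adjacency in `Γ` between two vertices of `s`. -/
def AdjIn {V : Type} (Γ : SimpleGraph V) (s : Set V) (a b : V) : Prop :=
  Γ.Adj a b ∧ a ∈ s ∧ b ∈ s

/-- `s` is nonempty and induces a connected subgraph. -/
def Conn {V : Type} (Γ : SimpleGraph V) (s : Set V) : Prop :=
  s.Nonempty ∧ ∀ a ∈ s, ∀ b ∈ s, Relation.ReflTransGen (AdjIn Γ s) a b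

/-- `s` and `t` share a vertex or are joined by an edge. -/
def Touch {V : Type} (Γ : SimpleGraph V) (s t : Set V) : Prop :=
  ∃ x ∈ s, ∃ y ∈ t, x = y ∨ Γ.Adj x y

section Conn

variable {V : Type} {Γ : SimpleGraph V} {s t : Set V}

lemma AdjIn.symm {a b : V} (h : AdjIn Γ s a b) : AdjIn Γ s b a :=
  ⟨h.1.symm, h.2.2, h.2.1⟩

lemma AdjIn.reach_mono (hst : s ⊆ t) {a b : V}
    (h : Relation.ReflTransGen (AdjIn Γ s) a b) : Relation.ReflTransGen (AdjIn Γ t) a b :=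
  h.lift id fun _ _ h => ⟨h.1, hst h.2.1, hst h.2.2⟩

lemma AdjIn.reach_symm {a b : V} (h : Relation.ReflTransGen (AdjIn Γ s) a b) :
    Relation.ReflTransGen (AdjIn Γ s) b a := by
  induction h with
  | refl => exact .refl
  | tail _ h ih => exact .head h.symm ih

lemma Conn.of_center {c : V} (hc : c ∈ s)
    (h : ∀ a ∈ s, Relation.ReflTransGen (AdjIn Γ s) c a) : Conn Γ s :=
  ⟨⟨c, hc⟩, fun a ha b hb => (AdjIn.reach_symm (h a ha)).trans (h b hb)⟩

lemma Conn.singleton (a : V) : Conn Γ {a} :=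
  Conn.of_center rfl (by rintro b rfl; exact .refl)

lemma Touch.symm (h : Touch Γ s t) : Touch Γ t s := by
  obtain ⟨x, hx, y, hy, h | h⟩ := h
  · exact ⟨y, hy, x, hx, .inl h.symm⟩
  · exact ⟨y, hy, x, hx, .inr h.symm⟩

lemma Touch.mono {s' t' : Set V} (h : Touch Γ s t) (hs : s ⊆ s') (ht : t ⊆ t') :
    Touch Γ s' t' := by
  obtain ⟨x, hx, y, hy, h⟩ := h
  exact ⟨x, hs hx, y, ht hy, h⟩

lemma Conn.union (hs : Conn Γ s) (ht : Conn Γ t) (h : Touch Γ s t) : Conn Γ (s ∪ t) := by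
  obtain ⟨x, hx, y, hy, h⟩ := h
  refine Conn.of_center (c := x) (.inl hx) ?_
  have hxy : Relation.ReflTransGen (AdjIn Γ (s ∪ t)) x y := by
    rcases h with rfl | h
    · exact .refl
    · exact .single ⟨h, .inl hx, .inr hy⟩
  rintro a (ha | ha)
  · exact AdjIn.reach_mono Set.subset_union_left (hs.2 x hx a ha)
  · exact hxy.trans (AdjIn.reach_mono Set.subset_union_right (ht.2 y hy a ha))

lemma Conn.iUnion {ι : Type} (hs : Conn Γ s) (f : ι → Set V)
    (h : ∀ i, Conn Γ (s ∪ f i)) : Conn Γ (s ∪ ⋃ i, f i) := by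
  obtain ⟨x, hx⟩ := hs.1
  refine Conn.of_center (c := x) (.inl hx) ?_
  rintro a (ha | ha)
  · exact AdjIn.reach_mono Set.subset_union_left (hs.2 x hx a ha)
  · obtain ⟨i, hi⟩ := Set.mem_iUnion.1 ha
    exact AdjIn.reach_mono (Set.union_subset_union_right _ (Set.subset_iUnion f i))
      ((h i).2 x (.inl hx) a (.inr hi))

lemma Conn.image_interval {p : ℕ → V} {a b : ℕ} (hab : a < b)
    (h : ∀ i, a ≤ i → i + 1 < b → Γ.Adj (p i) (p (i + 1))) : Conn Γ (p '' Set.Ico a b) := by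
  refine Conn.of_center (c := p a) ⟨a, ⟨le_rfl, hab⟩, rfl⟩ ?_
  rintro _ ⟨i, ⟨hi, hib⟩, rfl⟩
  induction i, hi using Nat.le_induction with
  | base => exact .refl
  | succ i hi ih =>
    exact (ih (by omega)).tail ⟨h i hi hib, ⟨i, ⟨hi, by omega⟩, rfl⟩, ⟨i + 1, ⟨by omega, hib⟩, rfl⟩⟩

lemma Conn.mono_graph {Γ' : SimpleGraph V} (h : Γ ≤ Γ') (hs : Conn Γ s) : Conn Γ' s :=
  ⟨hs.1, fun a ha b hb => (hs.2 a ha b hb).lift id fun _ _ k => ⟨h k.1, k.2⟩⟩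

lemma Conn.subset_or_disjoint {A : Set V} (hs : Conn Γ s)
    (h : ∀ a ∈ s, ∀ b ∈ s, Γ.Adj a b → a ∈ A → b ∈ A) {x y : V} (hx : x ∈ s) (hy : y ∈ s)
    (hxA : x ∈ A) : y ∈ A := by
  have := hs.2 x hx y hy
  clear hy
  induction this with
  | refl => exact hxA
  | tail _ hbc ih => exact h _ hbc.2.1 _ hbc.2.2 hbc.1 ih

lemma conn_iff_induce_connected : Conn Γ s ↔ (Γ.induce s).Connected := by
  constructor
  · rintro ⟨⟨c, hc⟩, h⟩
    rw [connected_iff]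
    refine ⟨?_, ⟨⟨c, hc⟩⟩⟩
    have key : ∀ a b, Relation.ReflTransGen (AdjIn Γ s) a b → ∀ (ha : a ∈ s) (hb : b ∈ s),
        (Γ.induce s).Reachable ⟨a, ha⟩ ⟨b, hb⟩ := by
      intro a b hab
      induction hab with
      | refl => intro _ _; exact .rfl
      | tail _ hbc ih =>
        intro ha hc
        exact (ih ha hbc.2.1).trans (Adj.reachable (by simpa using hbc.1))
    rintro ⟨a, ha⟩ ⟨b, hb⟩
    exact key a b (h a ha b hb) ha hb
  · intro h
    obtain ⟨⟨c, hc⟩⟩ := h.nonempty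
    refine ⟨⟨c, hc⟩, fun a ha b hb => ?_⟩
    obtain ⟨w⟩ := h.preconnected ⟨a, ha⟩ ⟨b, hb⟩
    have key : ∀ x y : s, (Γ.induce s).Walk x y →
        Relation.ReflTransGen (AdjIn Γ s) (x : V) (y : V) := by
      intro x y w
      induction w with
      | nil => exact .refl
      | @cons u v _ huv _ ih => exact .head ⟨by simpa using huv, u.2, v.2⟩ ih
    exact key _ _ w

end Conn

/-- `H` is a (not necessarily induced) minor of `Γ`. -/
def HasMinor {V W : Type} (Γ : SimpleGraph V) (H : SimpleGraph W) : Prop :=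
  ∃ β : W → Set V, (∀ w, Conn Γ (β w)) ∧ (∀ u v, u ≠ v → Disjoint (β u) (β v)) ∧
    ∀ u v, H.Adj u v → ∃ x ∈ β u, ∃ y ∈ β v, Γ.Adj x y

lemma HasMinor.mono {V W : Type} {Γ Γ' : SimpleGraph V} {H : SimpleGraph W} (h : Γ ≤ Γ')
    (hm : HasMinor Γ H) : HasMinor Γ' H := by
  obtain ⟨β, h1, h2, h3⟩ := hm
  refine ⟨β, fun w => (h1 w).mono_graph h, h2, fun u v huv => ?_⟩
  obtain ⟨x, hx, y, hy, hxy⟩ := h3 u v huv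
  exact ⟨x, hx, y, hy, h hxy⟩

/-- Hubs `β` that are linked through sets `M u v`, each attached to the hub `β u`, yield a minor. -/
lemma HasMinor.of_hubs {V U : Type} {Γ : SimpleGraph V} {H : SimpleGraph U} (β : U → Set V)
    (R : U → U → Prop) (M : U → U → Set V) (hβ : ∀ u, Conn Γ (β u))
    (hdisj : ∀ u v, u ≠ v → Disjoint (β u) (β v))
    (hR : ∀ u v, H.Adj u v → R u v ∨ R v u)
    (hconn : ∀ u v, R u v → Conn Γ (β u ∪ M u v))
    (hadj : ∀ u v, R u v → ∃ x ∈ β u ∪ M u v, ∃ y ∈ β v, Γ.Adj x y)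
    (hMβ : ∀ u v w, R u v → w ≠ u → Disjoint (M u v) (β w))
    (hMM : ∀ u v u' v', R u v → R u' v' → u ≠ u' → Disjoint (M u v) (M u' v')) :
    HasMinor Γ H := by
  refine ⟨fun u => β u ∪ ⋃ v : {v // R u v}, M u v, fun u => ?_, fun u v huv => ?_,
    fun u v huv => ?_⟩
  · exact (hβ u).iUnion _ fun v => hconn u v v.2
  · simp only [Set.disjoint_union_left, Set.disjoint_union_right, Set.disjoint_iUnion_left,
      Set.disjoint_iUnion_right]
    exact ⟨⟨hdisj u v huv, fun w => hMβ u w v w.2 huv.symm⟩,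
      fun w => ⟨(hMβ v w u w.2 huv).symm, fun w' => hMM u w' v w w'.2 w.2 huv⟩⟩
  · have key : ∀ u v, R u v → ∃ x ∈ β u ∪ ⋃ v : {v // R u v}, M u v,
        ∃ y ∈ β v ∪ ⋃ w : {w // R v w}, M v w, Γ.Adj x y := by
      intro u v h
      obtain ⟨x, hx, y, hy, hxy⟩ := hadj u v h
      refine ⟨x, ?_, y, .inl hy, hxy⟩
      rcases hx with hx | hx
      · exact .inl hx
      · exact .inr (Set.mem_iUnion.2 ⟨⟨v, h⟩, hx⟩)
    rcases hR u v huv with h | h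
    · exact key u v h
    · obtain ⟨x, hx, y, hy, hxy⟩ := key v u h
      exact ⟨y, hy, x, hx, hxy.symm⟩

/-- A family, indexed by `J`, of pairwise disjoint directed paths of the relation `E`, the `j`-th
one `p j 0, …, p j (n j)` leading from `X j` to `Y j`. -/
structure Linkage {V J : Type} (E : V → V → Prop) (X Y : J → Set V) where
  n : J → ℕ
  p : J → ℕ → V
  start : ∀ j, p j 0 ∈ X j
  finish : ∀ j, p j (n j) ∈ Y j
  adj : ∀ j i, i < n j → E (p j i) (p j (i + 1))
  inj : ∀ j j' i i', i ≤ n j → i' ≤ n j' → p j i = p j' i' → j = j' ∧ i = i'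

/-- The vertices reachable from `X` by a directed walk avoiding `S`. -/
def ReachAvoid {V : Type} (E : V → V → Prop) (X S : Set V) : Set V :=
  {v | ∃ x ∈ X, x ∉ S ∧ Relation.ReflTransGen (fun a b => E a b ∧ b ∉ S) x v}

section Menger

variable {V : Type} {E : V → V → Prop} {X Y S : Set V}

lemma ReachAvoid.of_mem {x : V} (hx : x ∈ X) (hS : x ∉ S) : x ∈ ReachAvoid E X S :=
  ⟨x, hx, hS, .refl⟩

lemma ReachAvoid.step {v w : V} (hv : v ∈ ReachAvoid E X S) (h : E v w) (hw : w ∉ S) :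
    w ∈ ReachAvoid E X S := by
  obtain ⟨x, hx, hxS, hr⟩ := hv
  exact ⟨x, hx, hxS, hr.tail ⟨h, hw⟩⟩

lemma ReachAvoid.along {p : ℕ → V} {a b : ℕ} (hab : a ≤ b) (ha : p a ∈ ReachAvoid E X S)
    (hE : ∀ i, a ≤ i → i < b → E (p i) (p (i + 1))) (hS : ∀ i, a < i → i ≤ b → p i ∉ S) :
    p b ∈ ReachAvoid E X S := by
  induction b, hab using Nat.le_induction with
  | base => exact ha
  | succ b hab ih =>
    exact ReachAvoid.step (ih (fun i h1 h2 => hE i h1 (by omega))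
      (fun i h1 h2 => hS i h1 (by omega))) (hE b hab (by omega)) (hS _ (by omega) le_rfl)

/-- Removing a directed edge. -/
def DelEdge (E : V → V → Prop) (x y : V) (a b : V) : Prop := E a b ∧ ¬ (a = x ∧ b = y)

lemma ReachAvoid.of_delEdge_fst {x y v : V} (S : Set V) (h : v ∈ ReachAvoid E X (insert x S)) :
    v ∈ ReachAvoid (DelEdge E x y) X S := by
  obtain ⟨z, hz, hzS, hr⟩ := h
  have key : v ∈ ReachAvoid (DelEdge E x y) X S ∧ v ≠ x := by
    induction hr with
    | refl => exact ⟨ReachAvoid.of_mem hz fun h => hzS (.inr h), fun h => hzS (.inl h)⟩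
    | tail _ h ih =>
      exact ⟨ReachAvoid.step ih.1 ⟨h.1, fun h' => ih.2 h'.1⟩ fun h' => h.2 (.inr h'), fun h' => h.2 (.inl h')⟩
  exact key.1

lemma ReachAvoid.of_delEdge_snd {x y v : V} (S : Set V) (h : v ∈ ReachAvoid E X (insert y S)) :
    v ∈ ReachAvoid (DelEdge E x y) X S := by
  obtain ⟨z, hz, hzS, hr⟩ := h
  induction hr with
  | refl => exact ReachAvoid.of_mem hz fun h => hzS (.inr h)
  | tail _ h ih => exact ReachAvoid.step ih ⟨h.1, fun h' => h.2 (.inl h'.2)⟩ fun h' => h.2 (.inr h')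

lemma menger_left {x y : V} {S : Set V} {Z : Set V}
    (hS : ∀ v ∈ Y, v ∉ ReachAvoid (DelEdge E x y) X S)
    (hZ : ∀ v ∈ insert x S, v ∉ ReachAvoid (DelEdge E x y) X Z) :
    ∀ v ∈ Y, v ∉ ReachAvoid E X Z := by
  rintro v hv ⟨z, hz, hzZ, hr⟩
  have key : v ∈ ReachAvoid (DelEdge E x y) X Z ∧ v ∈ ReachAvoid (DelEdge E x y) X S := by
    clear hv
    induction hr with
    | refl =>
      have h1 : z ∈ ReachAvoid (DelEdge E x y) X Z := ReachAvoid.of_mem hz hzZ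
      exact ⟨h1, ReachAvoid.of_mem hz fun h => hZ z (.inr h) h1⟩
    | @tail b c _ h ih =>
      have hE : DelEdge E x y b c := ⟨h.1, fun h' => hZ b (.inl h'.1) ih.1⟩
      have h1 : c ∈ ReachAvoid (DelEdge E x y) X Z := ReachAvoid.step ih.1 hE h.2
      exact ⟨h1, ReachAvoid.step ih.2 hE fun h' => hZ c (.inr h') h1⟩
  exact hS v hv key.2

lemma menger_right {x y : V} {S : Set V} {Z : Set V}
    (hS : ∀ v ∈ Y, v ∉ ReachAvoid (DelEdge E x y) X S)
    (hZ : ∀ v ∈ Y, v ∉ ReachAvoid (DelEdge E x y) (insert y S) Z) :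
    ∀ v ∈ Y, v ∉ ReachAvoid E X Z := by
  rintro v hv ⟨z, hz, hzZ, hr⟩
  have key : (z ∉ Z → Relation.ReflTransGen (fun a b => DelEdge E x y a b ∧ b ∉ Z) z v) ∧
      (Relation.ReflTransGen (fun a b => DelEdge E x y a b ∧ b ∉ S) z v) := by
    clear hz hzZ
    induction hr using Relation.ReflTransGen.head_induction_on with
    | refl => exact ⟨fun _ => .refl, .refl⟩
    | @head a c h _ ih =>
      have hc := ih.1 h.2
      have hcn : c ∉ insert y S := fun h' => hZ v hv ⟨c, h', h.2, hc⟩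
      have hE : DelEdge E x y a c := ⟨h.1, fun h' => hcn (.inl h'.2)⟩
      exact ⟨fun _ => .head ⟨hE, h.2⟩ hc, .head ⟨hE, fun h' => hcn (.inr h')⟩ ih.2⟩
  by_cases hzS : z ∈ S
  · exact hZ v hv ⟨z, .inr hzS, hzZ, key.1 hzZ⟩
  · exact hS v hv ⟨z, hz, hzS, key.2⟩

open Classical in
lemma menger_combine {x y : V} {S : Finset V} {k : ℕ} (hxy : E x y) (hx : x ∉ S) (hy : y ∉ S)
    (hcard : S.card + 1 = k)
    (hS : ∀ v ∈ Y, v ∉ ReachAvoid (DelEdge E x y) X S)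
    (P : Linkage (DelEdge E x y) (fun _ : Fin k => X) (fun _ => insert x (S : Set V)))
    (Q : Linkage (DelEdge E x y) (fun _ : Fin k => insert y (S : Set V)) (fun _ => Y)) :
    Nonempty (Linkage E (fun _ : Fin k => X) (fun _ => Y)) := by
  have hP0 : Finset.univ.image (fun i => P.p i (P.n i)) = insert x S := by
    refine Finset.eq_of_subset_of_card_le ?_ ?_
    · intro v hv
      obtain ⟨i, -, rfl⟩ := Finset.mem_image.1 hv
      simpa using P.finish i
    · rw [Finset.card_image_of_injective _ (fun i j h => (P.inj i j _ _ le_rfl le_rfl h).1),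
        Finset.card_insert_of_notMem hx, hcard, Finset.card_univ, Fintype.card_fin]
  have hQ0 : Finset.univ.image (fun i => Q.p i 0) = insert y S := by
    refine Finset.eq_of_subset_of_card_le ?_ ?_
    · intro v hv
      obtain ⟨i, -, rfl⟩ := Finset.mem_image.1 hv
      simpa using Q.start i
    · rw [Finset.card_image_of_injective _
        (fun i j h => (Q.inj i j _ _ (Nat.zero_le _) (Nat.zero_le _) h).1),
        Finset.card_insert_of_notMem hy, hcard, Finset.card_univ, Fintype.card_fin]
  have hP1 : ∀ i a, a ≤ P.n i → P.p i a ∈ S → a = P.n i := by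
    intro i a ha h
    have : P.p i a ∈ Finset.univ.image (fun i => P.p i (P.n i)) := by
      rw [hP0]; exact Finset.mem_insert_of_mem h
    obtain ⟨l, -, hl⟩ := Finset.mem_image.1 this
    obtain ⟨rfl, h2⟩ := P.inj _ _ _ _ le_rfl ha hl
    exact h2.symm
  have hQ1 : ∀ i a, a ≤ Q.n i → Q.p i a ∈ S → a = 0 := by
    intro i a ha h
    have : Q.p i a ∈ Finset.univ.image (fun i => Q.p i 0) := by
      rw [hQ0]; exact Finset.mem_insert_of_mem h
    obtain ⟨l, -, hl⟩ := Finset.mem_image.1 this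
    exact (Q.inj _ _ _ _ (Nat.zero_le _) ha hl).2.symm
  have hPQ : ∀ i j a b, a ≤ P.n i → b ≤ Q.n j → P.p i a = Q.p j b → P.p i a ∈ S := by
    intro i j a b ha hb h
    by_contra hn
    have hpre : ∀ a', a' ≤ a → P.p i a' ∉ S := by
      intro a' ha' h'
      have := hP1 i a' (by omega) h'
      have : a' = a := by omega
      exact hn (this ▸ h')
    have h1 : P.p i a ∈ ReachAvoid (DelEdge E x y) X S :=
      ReachAvoid.along (Nat.zero_le a) (ReachAvoid.of_mem (P.start i) (hpre 0 (Nat.zero_le _)))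
        (fun l _ hl => P.adj i l (by omega)) (fun l _ hl => hpre l hl)
    rw [h] at h1
    refine hS _ (Q.finish j) (ReachAvoid.along hb h1 (fun l _ hl => Q.adj j l hl) ?_)
    intro l hl hl' h'
    have := hQ1 j l hl' h'
    omega
  have hσ : ∀ i, ∃ j, Q.p j 0 = if P.p i (P.n i) = x then y else P.p i (P.n i) := by
    intro i
    have : (if P.p i (P.n i) = x then y else P.p i (P.n i)) ∈
        Finset.univ.image (fun i => Q.p i 0) := by
      rw [hQ0]
      split_ifs with h
      · exact Finset.mem_insert_self _ _
      · have := P.finish i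
        simp only [Set.mem_insert_iff, h, false_or] at this
        exact Finset.mem_insert_of_mem this
    obtain ⟨j, -, hj⟩ := Finset.mem_image.1 this
    exact ⟨j, hj⟩
  choose σ hσ using hσ
  have hσi : ∀ i j, σ i = σ j → i = j := by
    intro i j hij
    have h1 := hσ i
    rw [hij, hσ j] at h1
    have hi := P.finish i
    have hj := P.finish j
    refine (P.inj i j _ _ le_rfl le_rfl ?_).1
    simp only [Set.mem_insert_iff, Finset.mem_coe] at hi hj
    split_ifs at h1 with h2 h3 h3
    · rw [h2, h3]
    · rw [← h1] at hi; simp_all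
    · rw [h1] at hj; simp_all
    · exact h1.symm
  set d : Fin k → ℕ := fun i => if P.p i (P.n i) = x then 1 else 0 with hd
  have hd1 : ∀ i, d i ≤ 1 := by intro i; simp only [hd]; split_ifs <;> omega
  have cross : ∀ i j a b, a ≤ P.n i → P.n j < b → b ≤ P.n j + d j + Q.n (σ j) →
      P.p i a ≠ Q.p (σ j) (b - P.n j - d j) := by
    intro i j a b ha hb hb' h
    have hdj := hd1 j
    have hmem := hPQ i (σ j) a _ ha (by omega) h
    have h0 : b - P.n j - d j = 0 := hQ1 (σ j) _ (by omega) (h ▸ hmem)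
    have hd' : P.p j (P.n j) = x := by
      by_contra hne
      have : d j = 0 := by simp [hd, hne]
      omega
    rw [h, h0, hσ j, if_pos hd'] at hmem
    exact hy hmem
  refine ⟨⟨fun i => P.n i + d i + Q.n (σ i),
    fun i a => if a ≤ P.n i then P.p i a else Q.p (σ i) (a - P.n i - d i), ?_, ?_, ?_, ?_⟩⟩
  · intro i; simpa using P.start i
  · intro i
    split_ifs with h
    · have hdi : d i = 0 := by omega
      have hq : Q.n (σ i) = 0 := by omega
      have hne : P.p i (P.n i) ≠ x := by
        intro h'; simp [hd, h'] at hdi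
      have := hσ i
      rw [if_neg hne] at this
      rw [hdi, hq, add_zero, add_zero, ← this]
      have := Q.finish (σ i)
      rwa [hq] at this
    · have : P.n i + d i + Q.n (σ i) - P.n i - d i = Q.n (σ i) := by omega
      rw [this]; exact Q.finish _
  · intro i a ha
    have hdi := hd1 i
    rcases lt_trichotomy a (P.n i) with h | h | h
    · rw [if_pos h.le, if_pos (by omega)]; exact (P.adj i a h).1
    · subst h
      rw [if_pos le_rfl, if_neg (by omega)]
      by_cases hx' : P.p i (P.n i) = x
      · have h1 : d i = 1 := by simp [hd, hx']
        have h2 := hσ i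
        rw [if_pos hx'] at h2
        rw [show P.n i + 1 - P.n i - d i = 0 by omega, h2, hx']
        exact hxy
      · have h1 : d i = 0 := by simp [hd, hx']
        have h2 := hσ i
        rw [if_neg hx'] at h2
        rw [show P.n i + 1 - P.n i - d i = 0 + 1 by omega, ← h2]
        exact (Q.adj (σ i) 0 (by omega)).1
    · rw [if_neg (by omega), if_neg (by omega),
        show a + 1 - P.n i - d i = (a - P.n i - d i) + 1 by omega]
      exact (Q.adj (σ i) _ (by omega)).1
  · intro i j a b ha hb h
    have hdi := hd1 i
    have hdj := hd1 j
    split_ifs at h with h1 h2 h2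
    · exact P.inj _ _ _ _ h1 h2 h
    · exact absurd h (cross i j a b h1 (by omega) hb)
    · exact absurd h.symm (cross j i b a h2 (by omega) ha)
    · obtain ⟨h3, h4⟩ := Q.inj _ _ _ _ (by omega) (by omega) h
      obtain rfl := hσi _ _ h3
      exact ⟨rfl, by omega⟩

open Classical in
/-- Menger's theorem for directed graphs on a finite vertex set. -/
theorem menger [Finite V] (E : V → V → Prop) (X Y : Set V) (k : ℕ)
    (h : ∀ S : Finset V, (∀ y ∈ Y, y ∉ ReachAvoid E X S) → k ≤ S.card) :
    Nonempty (Linkage E (fun _ : Fin k => X) (fun _ => Y)) := by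
  induction hm : {e : V × V | E e.1 e.2}.ncard using Nat.strong_induction_on
    generalizing E X Y with
  | _ m ih =>
  by_cases hE : ∃ x y, E x y
  · obtain ⟨x, y, hxy⟩ := hE
    have hlt : {e : V × V | DelEdge E x y e.1 e.2}.ncard < m := by
      rw [← hm]
      refine Set.ncard_lt_ncard ⟨fun e he => he.1, fun hsub => ?_⟩ (Set.toFinite _)
      exact (hsub (show (x, y) ∈ {e : V × V | E e.1 e.2} from hxy)).2 ⟨rfl, rfl⟩
    by_cases hdel : ∀ S : Finset V, (∀ v ∈ Y, v ∉ ReachAvoid (DelEdge E x y) X S) → k ≤ S.card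
    · obtain ⟨L⟩ := ih _ hlt (DelEdge E x y) X Y hdel rfl
      exact ⟨⟨L.n, L.p, L.start, L.finish, fun j i hi => (L.adj j i hi).1, L.inj⟩⟩
    · push Not at hdel
      obtain ⟨S, hS, hSk⟩ := hdel
      have hx1 : k ≤ (insert x S).card := h _ fun v hv hr =>
        hS v hv (ReachAvoid.of_delEdge_fst _ (by simpa using hr))
      have hy1 : k ≤ (insert y S).card := h _ fun v hv hr =>
        hS v hv (ReachAvoid.of_delEdge_snd _ (by simpa using hr))
      have hx : x ∉ S := fun h' => by rw [Finset.insert_eq_of_mem h'] at hx1; omega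
      have hy : y ∉ S := fun h' => by rw [Finset.insert_eq_of_mem h'] at hy1; omega
      have hc : S.card + 1 = k := by rw [Finset.card_insert_of_notMem hx] at hx1; omega
      obtain ⟨P⟩ := ih _ hlt (DelEdge E x y) X (insert x S)
        (fun Z hZ => h Z (menger_left hS hZ)) rfl
      obtain ⟨Q⟩ := ih _ hlt (DelEdge E x y) (insert y S) Y
        (fun Z hZ => h Z (menger_right hS hZ)) rfl
      exact menger_combine hxy hx hy hc hS P Q
  · push Not at hE
    have hk := h (Set.toFinite (X ∩ Y)).toFinset (by
      rintro y hy ⟨x, hx, hxS, hr⟩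
      cases hr with
      | refl => exact hxS (by simp [hx, hy])
      | tail _ h => exact hE _ _ h.1)
    obtain ⟨T, hT, hTk⟩ := Finset.exists_subset_card_eq hk
    let f := T.equivFin.symm
    refine ⟨⟨fun _ => 0, fun j _ => (f (Fin.cast hTk.symm j) : V), ?_, ?_, ?_, ?_⟩⟩
    · intro j
      have := hT (f (Fin.cast hTk.symm j)).2
      simp at this; exact this.1
    · intro j
      have := hT (f (Fin.cast hTk.symm j)).2
      simp at this; exact this.2
    · intro j i hi; omega
    · intro j j' i i' hi hi' h
      have := f.injective (Subtype.ext h)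
      exact ⟨by simpa using this, by omega⟩

end Menger

/-- Two vertex sets are joined by an edge or through a connected subset of `D`. -/
def LinkedIn {V : Type} (Γ : SimpleGraph V) (D s t : Set V) : Prop :=
  ∃ x ∈ s, ∃ y ∈ t, Γ.Adj x y ∨
    ∃ L ⊆ D, Conn Γ L ∧ (∃ u ∈ L, Γ.Adj x u) ∧ ∃ v ∈ L, Γ.Adj v y

lemma LinkedIn.symm {V : Type} {Γ : SimpleGraph V} {D s t : Set V} (h : LinkedIn Γ D s t) :
    LinkedIn Γ D t s := by
  obtain ⟨x, hx, y, hy, h | ⟨L, hL, hc, ⟨u, hu, hxu⟩, v, hv, hvy⟩⟩ := h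
  · exact ⟨y, hy, x, hx, .inl h.symm⟩
  · exact ⟨y, hy, x, hx, .inr ⟨L, hL, hc, ⟨v, hv, hvy.symm⟩, u, hu, hxu.symm⟩⟩

lemma LinkedIn.mono {V : Type} {Γ : SimpleGraph V} {D D' s s' t t' : Set V}
    (h : LinkedIn Γ D s t) (hD : D ⊆ D') (hs : s ⊆ s') (ht : t ⊆ t') : LinkedIn Γ D' s' t' := by
  obtain ⟨x, hx, y, hy, h | ⟨L, hL, h⟩⟩ := h
  · exact ⟨x, hs hx, y, ht hy, .inl h⟩
  · exact ⟨x, hs hx, y, ht hy, .inr ⟨L, hL.trans hD, h⟩⟩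

lemma LinkedIn.exists_attached {V : Type} {Γ : SimpleGraph V} {D s t : Set V}
    (h : LinkedIn Γ D s t) : ∃ L ⊆ D, ∃ x ∈ s, Conn Γ ({x} ∪ L) ∧
      ∃ z ∈ ({x} ∪ L : Set V), ∃ y ∈ t, Γ.Adj z y := by
  obtain ⟨x, hx, y, hy, h | ⟨L, hL, hc, ⟨u, hu, hxu⟩, v, hv, hvy⟩⟩ := h
  · exact ⟨∅, Set.empty_subset _, x, hx, by simpa using Conn.singleton x, x, by simp, y, hy, h⟩
  · exact ⟨L, hL, x, hx, (Conn.singleton x).union hc ⟨x, rfl, u, hu, .inr hxu⟩,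
      v, .inr hv, y, hy, hvy⟩

lemma strictMono_of_lt_succ_le {α : ℕ → ℕ} {T : ℕ} (h : ∀ t < T, α t < α (t + 1)) {s t : ℕ}
    (hst : s < t) (ht : t ≤ T) : α s < α t := by
  induction t, hst using Nat.le_induction with
  | base => exact h s (by omega)
  | succ t hst ih => exact (ih (by omega)).trans (h t (by omega))

lemma mono_of_lt_succ_le {α : ℕ → ℕ} {T : ℕ} (h : ∀ t < T, α t < α (t + 1)) {s t : ℕ}
    (hst : s ≤ t) (ht : t ≤ T) : α s ≤ α t := by
  rcases hst.eq_or_lt with rfl | hst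
  · exact le_rfl
  · exact (strictMono_of_lt_succ_le h hst ht).le

lemma eq_of_mul_add_eq {r a a' b b' : ℕ} (ha : a < r) (ha' : a' < r)
    (h : b * r + a = b' * r + a') : b = b' ∧ a = a' := by
  have e1 := congrArg (· / r) h
  have e2 := congrArg (· % r) h
  have hr : 0 < r := by omega
  simp only [Nat.mul_comm _ r, Nat.mul_add_div hr, Nat.div_eq_of_lt ha, Nat.div_eq_of_lt ha',
    Nat.mul_add_mod, Nat.mod_eq_of_lt ha, Nat.mod_eq_of_lt ha'] at e1 e2
  exact ⟨by simpa using e1, e2⟩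

lemma hasMinor_wall_of_grid {V : Type} {Γ : SimpleGraph V} {r : ℕ} (hr : 0 < r)
    (ρ : Fin r → ℕ → V) (N : Fin r → ℕ) (α : Fin r → ℕ → ℕ) (D : ℕ → Set V)
    (hadj : ∀ a i, i < N a → Γ.Adj (ρ a i) (ρ a (i + 1)))
    (hinj : ∀ a a' i i', i ≤ N a → i' ≤ N a' → ρ a i = ρ a' i' → a = a' ∧ i = i')
    (hα : ∀ a, ∀ t < 2 * r * r, α a t < α a (t + 1))
    (hαN : ∀ a, ∀ t ≤ 2 * r * r, α a t ≤ N a + 1)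
    (hD : ∀ t < 2 * r * r, ∀ t' < 2 * r * r, t ≠ t' → Disjoint (D t) (D t'))
    (hDρ : ∀ t < 2 * r * r, ∀ a, ∀ i ≤ N a, ρ a i ∉ D t)
    (hlink : ∀ t < 2 * r * r, ∀ a a' : Fin r, a.val + 1 = a'.val →
      LinkedIn Γ (D t) (ρ a '' Set.Ico (α a t) (α a (t + 1)))
        (ρ a' '' Set.Ico (α a' t) (α a' (t + 1)))) :
    HasMinor Γ (Wall r) := by
  have hb : ∀ (a : Fin r) (b : Fin (2 * r)), b.val * r + a.val < 2 * r * r := by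
    intro a b
    have h1 : (b.val + 1) * r ≤ 2 * r * r := Nat.mul_le_mul_right r b.2
    have := a.2
    nlinarith
  have hb1 : ∀ b : Fin (2 * r), (b.val + 1) * r ≤ 2 * r * r := fun b =>
    Nat.mul_le_mul_right r b.2
  have hb2 : ∀ (b : ℕ), b * r < (b + 1) * r := by intro b; nlinarith
  have hlink' : ∀ (t : ℕ) (a a' : Fin r), ∃ L : Set V, t < 2 * r * r → a.val + 1 = a'.val →
      L ⊆ D t ∧ ∃ x ∈ ρ a '' Set.Ico (α a t) (α a (t + 1)), Conn Γ ({x} ∪ L) ∧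
      ∃ z ∈ ({x} ∪ L : Set V), ∃ y ∈ ρ a' '' Set.Ico (α a' t) (α a' (t + 1)), Γ.Adj z y := by
    intro t a a'
    by_cases h : t < 2 * r * r ∧ a.val + 1 = a'.val
    · obtain ⟨L, h1, h2⟩ := (hlink t h.1 a a' h.2).exists_attached
      exact ⟨L, fun _ _ => ⟨h1, h2⟩⟩
    · exact ⟨∅, fun h1 h2 => absurd ⟨h1, h2⟩ h⟩
  choose L hL using hlink'
  let β : Fin r × Fin (2 * r) → Set V := fun u =>
    ρ u.1 '' Set.Ico (α u.1 (u.2.val * r)) (α u.1 ((u.2.val + 1) * r))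
  let R : Fin r × Fin (2 * r) → Fin r × Fin (2 * r) → Prop := fun u v =>
    (u.1 = v.1 ∧ u.2.val + 1 = v.2.val) ∨ (u.2 = v.2 ∧ u.1.val + 1 = v.1.val)
  let M : Fin r × Fin (2 * r) → Fin r × Fin (2 * r) → Set V := fun u v =>
    if u.1 = v.1 then ∅ else L (u.2.val * r + u.1.val) u.1 v.1
  have hcell : ∀ (u : Fin r × Fin (2 * r)) (a' : Fin r),
      ρ a' '' Set.Ico (α a' (u.2.val * r + u.1.val)) (α a' (u.2.val * r + u.1.val + 1)) ⊆
        β (a', u.2) := by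
    intro u a'
    refine Set.image_mono (Set.Ico_subset_Ico ?_ ?_)
    · exact mono_of_lt_succ_le (hα a') (Nat.le_add_right _ _) (hb u.1 u.2).le
    · refine mono_of_lt_succ_le (hα a') ?_ (hb1 u.2)
      have := u.1.2
      dsimp only
      nlinarith
  have hβN : ∀ u : Fin r × Fin (2 * r), α u.1 ((u.2.val + 1) * r) ≤ N u.1 + 1 := fun u =>
    hαN u.1 _ (hb1 u.2)
  have hM : ∀ u v, R u v → M u v ⊆ D (u.2.val * r + u.1.val) := by
    intro u v h
    simp only [M]
    split_ifs with h1
    · exact Set.empty_subset _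
    · rcases h with h | h
      · exact absurd h.1 h1
      · exact (hL _ u.1 v.1 (hb u.1 u.2) h.2).1
  have hβ : ∀ u, Conn Γ (β u) := by
    intro u
    refine Conn.image_interval ?_ ?_
    · exact strictMono_of_lt_succ_le (hα u.1) (hb2 _) (hb1 u.2)
    · intro i _ hi
      have := hβN u
      exact hadj u.1 i (by omega)
  refine HasMinor.of_hubs β R M hβ ?_ ?_ ?_ ?_ ?_ ?_
  · intro u v huv
    rw [Set.disjoint_left]
    rintro _ ⟨i, hi, rfl⟩ ⟨j, hj, hij⟩
    rw [Set.mem_Ico] at hi hj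
    have h1 := hβN u
    have h2 := hβN v
    obtain ⟨h3, rfl⟩ := hinj _ _ _ _ (by omega) (by omega) hij
    have h4 : u.2.val ≠ v.2.val := fun h => huv (Prod.ext h3.symm (Fin.ext h))
    rw [h3] at hj
    rcases h4.lt_or_gt with h | h
    · have h5 : (u.2.val + 1) * r ≤ v.2.val * r := Nat.mul_le_mul_right r h
      have h6 := mono_of_lt_succ_le (hα u.1) h5 ((hb2 _).le.trans (hb1 v.2))
      omega
    · have h5 : (v.2.val + 1) * r ≤ u.2.val * r := Nat.mul_le_mul_right r h
      have h6 := mono_of_lt_succ_le (hα u.1) h5 ((hb2 _).le.trans (hb1 u.2))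
      omega
  · intro u v huv
    simp only [Wall, SimpleGraph.fromRel_adj] at huv
    simp only [R]
    tauto
  · intro u v h
    simp only [M]
    split_ifs with h1
    · simpa using hβ u
    · rcases h with h | h
      · exact absurd h.1 h1
      · obtain ⟨h2, x, hx, hc, -⟩ := hL _ u.1 v.1 (hb u.1 u.2) h.2
        have hxβ : x ∈ β u := hcell u u.1 hx
        have := (hβ u).union hc ⟨x, hxβ, x, .inl rfl, .inl rfl⟩
        rwa [← Set.union_assoc, Set.union_eq_self_of_subset_right
          (Set.singleton_subset_iff.2 hxβ)] at this
  · intro u v h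
    by_cases h1 : u.1 = v.1
    · rcases h with h | h
      · have hN := hβN v
        have hlt := strictMono_of_lt_succ_le (hα v.1) (hb2 v.2.val) (hb1 v.2)
        have hlt' := strictMono_of_lt_succ_le (hα u.1) (hb2 u.2.val) (hb1 u.2)
        rw [← h.2, ← h1] at hlt
        rw [← h.2, ← h1] at hN
        refine ⟨ρ u.1 (α u.1 ((u.2.val + 1) * r) - 1), .inl ⟨_, ⟨by omega, by omega⟩, rfl⟩,
          ρ u.1 (α u.1 ((u.2.val + 1) * r)), ⟨_, ⟨?_, ?_⟩, by rw [h1]⟩, ?_⟩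
        · rw [← h.2, ← h1]
        · rw [← h.2, ← h1]; exact hlt
        · have := hadj u.1 (α u.1 ((u.2.val + 1) * r) - 1) (by omega)
          rwa [show α u.1 ((u.2.val + 1) * r) - 1 + 1 = α u.1 ((u.2.val + 1) * r) by omega] at this
      · rw [h1] at h; omega
    · rcases h with h | h
      · exact absurd h.1 h1
      · obtain ⟨h2, x, hx, -, z, hz, y, hy, hzy⟩ := hL _ u.1 v.1 (hb u.1 u.2) h.2
        have hxβ : x ∈ β u := hcell u u.1 hx
        have hyβ : y ∈ β (v.1, u.2) := hcell u v.1 hy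
        rw [h.1] at hyβ
        refine ⟨z, ?_, y, hyβ, hzy⟩
        simp only [M, if_neg h1]
        rcases hz with rfl | hz
        · exact .inl hxβ
        · exact .inr hz
  · intro u v w h _
    rw [Set.disjoint_left]
    rintro _ hx ⟨i, hi, rfl⟩
    rw [Set.mem_Ico] at hi
    have := hβN w
    exact hDρ _ (hb u.1 u.2) w.1 i (by omega) (hM u v h hx)
  · intro u v u' v' h h' huu
    refine (hD _ (hb u.1 u.2) _ (hb u'.1 u'.2) ?_).mono (hM u v h) (hM u' v' h')
    intro he
    obtain ⟨e1, e2⟩ := eq_of_mul_add_eq u.1.2 u'.1.2 he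
    exact huu (Prod.ext (Fin.ext e2) (Fin.ext e1))

lemma LinkedIn.trans {V : Type} {Γ : SimpleGraph V} {D s m t : Set V} (hm : Conn Γ m)
    (h1 : LinkedIn Γ D s m) (h2 : LinkedIn Γ D m t) : LinkedIn Γ (D ∪ m) s t := by
  have key : ∀ s, LinkedIn Γ D m s → ∃ L ⊆ D, Conn Γ (m ∪ L) ∧
      ∃ y ∈ s, ∃ z ∈ m ∪ L, Γ.Adj z y := by
    intro s h
    obtain ⟨L, hL, x, hx, hc, z, hz, y, hy, hzy⟩ := h.exists_attached
    refine ⟨L, hL, ?_, y, hy, z, ?_, hzy⟩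
    · have := hm.union hc ⟨x, hx, x, .inl rfl, .inl rfl⟩
      rwa [← Set.union_assoc, Set.union_eq_self_of_subset_right
        (Set.singleton_subset_iff.2 hx)] at this
    · rcases hz with rfl | hz
      · exact .inl hx
      · exact .inr hz
  obtain ⟨L₁, hL₁, hc₁, x, hx, u, hu, hxu⟩ := key s h1.symm
  obtain ⟨L₂, hL₂, hc₂, y, hy, v, hv, hvy⟩ := key t h2
  obtain ⟨a, ha⟩ := hm.1
  refine ⟨x, hx, y, hy, .inr ⟨(m ∪ L₁) ∪ (m ∪ L₂), ?_,
    hc₁.union hc₂ ⟨a, .inl ha, a, .inl ha, .inl rfl⟩, ⟨u, .inl hu, hxu.symm⟩, v, .inr hv, hvy⟩⟩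
  rintro z ((hz | hz) | (hz | hz))
  · exact .inr hz
  · exact .inl (hL₁ hz)
  · exact .inr hz
  · exact .inl (hL₂ hz)

open Classical in
lemma exists_path_or_star {I : Type} [Fintype I] (H : SimpleGraph I) (hH : H.Connected) (r : ℕ)
    (hcard : (r + 1) ^ r < Fintype.card I) :
    (∃ v : Fin r → I, Function.Injective v ∧
      ∀ a a' : Fin r, a.val + 1 = a'.val → H.Adj (v a) (v a')) ∨
    ∃ c, ∃ v : Fin r → I, Function.Injective v ∧ ∀ a, H.Adj c (v a) := by
  obtain ⟨c⟩ := hH.nonempty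
  by_cases hdist : ∃ w, r ≤ H.dist c w
  · obtain ⟨w, hw⟩ := hdist
    obtain ⟨p, hp⟩ := hH.exists_walk_length_eq_dist c w
    have hpath := p.isPath_of_length_eq_dist hp
    refine .inl ⟨fun a => p.getVert a, fun a a' h => ?_, fun a a' h => ?_⟩
    · have := a.2
      have := a'.2
      exact Fin.ext (hpath.getVert_injOn (by simp; omega) (by simp; omega) h)
    · have := a'.2
      dsimp only
      rw [← h]
      exact p.adj_getVert_succ (by omega)
  · push Not at hdist
    by_cases hdeg : ∃ c, r ≤ (H.neighborFinset c).card
    · obtain ⟨c, hc⟩ := hdeg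
      obtain ⟨T, hT, hTr⟩ := Finset.exists_subset_card_eq hc
      refine .inr ⟨c, fun a => T.equivFin.symm (Fin.cast hTr.symm a), fun a a' h => ?_, fun a => ?_⟩
      · simpa using T.equivFin.symm.injective (Subtype.ext h)
      · have := hT (T.equivFin.symm (Fin.cast hTr.symm a)).2
        simpa using this
    · push Not at hdeg
      exfalso
      let B : ℕ → Finset I := fun d => Nat.rec {c} (fun _ s => s ∪ s.biUnion fun x => H.neighborFinset x) d
      have hB : ∀ d, (B d).card ≤ (r + 1) ^ d := by
        intro d
        induction d with
        | zero => simp [B]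
        | succ d ih =>
          have h1 : B (d + 1) = B d ∪ (B d).biUnion fun x => H.neighborFinset x := rfl
          have h2 : ((B d).biUnion fun x => H.neighborFinset x).card ≤ (B d).card * r :=
            Finset.card_biUnion_le_card_mul _ _ _ fun x _ => (hdeg x).le
          have h3 := Finset.card_union_le (B d) ((B d).biUnion fun x => H.neighborFinset x)
          rw [h1, pow_succ]
          nlinarith
      have hmono : Monotone B := monotone_nat_of_le_succ fun d => Finset.subset_union_left
      have hall : Finset.univ ⊆ B r := by
        intro w _
        obtain ⟨p, hp⟩ := hH.exists_walk_length_eq_dist c w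
        have key : ∀ i, i ≤ p.length → p.getVert i ∈ B i := by
          intro i
          induction i with
          | zero => simp [B]
          | succ i ih =>
            intro hi
            refine Finset.mem_union_right _ (Finset.mem_biUnion.2 ⟨_, ih (by omega), ?_⟩)
            simpa using p.adj_getVert_succ (i := i) (by omega)
        have := key p.length le_rfl
        rw [p.getVert_length] at this
        exact hmono (by rw [hp]; exact (hdist w).le) this
      have := (Finset.card_le_card hall).trans (hB r)
      rw [Finset.card_univ] at this
      omega

lemma exists_increasing_enumeration (F : Finset ℕ) {m : ℕ} (hm : m ≤ F.card) :
    ∃ e : ℕ → ℕ, (∀ t < m, e t ∈ F) ∧ ∀ s t, s < t → t < m → e s < e t := by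
  refine ⟨fun t => if h : t < F.card then F.orderEmbOfFin rfl ⟨t, h⟩ else 0, fun t ht => ?_,
    fun s t hst ht => ?_⟩
  · simp only [show t < F.card by omega, dif_pos]; exact F.orderEmbOfFin_mem rfl _
  · dsimp only
    rw [dif_pos (by omega), dif_pos (by omega)]
    simpa using hst

/-- The set of vertices of the `i`-th path. -/
def rowSet {V I : Type} (ρ : I → ℕ → V) (N : I → ℕ) (i : I) : Set V := ρ i '' Set.Iic (N i)

/-- The graph on the rows in which two of them are adjacent if they are linked through `C`. -/
def rowGraph {V I : Type} (Γ : SimpleGraph V) (ρ : I → ℕ → V) (N : I → ℕ) (C : Set V) :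
    SimpleGraph I where
  Adj i j := i ≠ j ∧
    LinkedIn Γ (C \ ⋃ k, rowSet ρ N k) (rowSet ρ N i ∩ C) (rowSet ρ N j ∩ C)
  symm := ⟨fun _ _ h => ⟨h.1.symm, h.2.symm⟩⟩
  loopless := ⟨fun _ h => h.1 rfl⟩

lemma rowGraph_connected {V I : Type} [Nonempty I] {Γ : SimpleGraph V} {ρ : I → ℕ → V} {N : I → ℕ}
    {C : Set V} (hC : Conn Γ C)
    (hinj : ∀ a a' i i', i ≤ N a → i' ≤ N a' → ρ a i = ρ a' i' → a = a' ∧ i = i')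
    (hmeet : ∀ i, ∃ x ≤ N i, ρ i x ∈ C) : (rowGraph Γ ρ N C).Connected := by
  rw [connected_iff]
  refine ⟨fun i j => ?_, inferInstance⟩
  have huniq : ∀ i j v, v ∈ rowSet ρ N i → v ∈ rowSet ρ N j → i = j := by
    rintro i j _ ⟨x, hx, rfl⟩ ⟨y, hy, hxy⟩
    exact (hinj j i y x hy hx hxy).1.symm
  obtain ⟨x, hx, hxC⟩ := hmeet i
  obtain ⟨y, hy, hyC⟩ := hmeet j
  have key : ∀ w, Relation.ReflTransGen (AdjIn Γ C) (ρ i x) w →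
      ∃ i', (rowGraph Γ ρ N C).Reachable i i' ∧ ∃ z ∈ rowSet ρ N i' ∩ C, w = z ∨
        ∃ L ⊆ C \ ⋃ k, rowSet ρ N k, Conn Γ L ∧ (∃ u ∈ L, Γ.Adj z u) ∧ w ∈ L := by
    intro w hw
    induction hw with
    | refl => exact ⟨i, .rfl, _, ⟨⟨x, hx, rfl⟩, hxC⟩, .inl rfl⟩
    | @tail b c _ hbc ih =>
      obtain ⟨i', hi', z, hz, hb⟩ := ih
      by_cases hc : ∃ j', c ∈ rowSet ρ N j'
      · obtain ⟨j', hj'⟩ := hc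
        by_cases hij : i' = j'
        · subst hij
          exact ⟨i', hi', c, ⟨hj', hbc.2.2⟩, .inl rfl⟩
        · have hcj : c ∈ rowSet ρ N j' ∩ C := ⟨hj', hbc.2.2⟩
          have h : (rowGraph Γ ρ N C).Adj i' j' := by
            refine ⟨hij, z, hz, c, hcj, ?_⟩
            rcases hb with rfl | ⟨L, hL, hLc, hzL, hbL⟩
            · exact .inl hbc.1
            · exact .inr ⟨L, hL, hLc, hzL, b, hbL, hbc.1⟩
          exact ⟨j', hi'.trans h.reachable, c, hcj, .inl rfl⟩
      · have hcD : c ∈ C \ ⋃ k, rowSet ρ N k := ⟨hbc.2.2, by simpa using hc⟩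
        refine ⟨i', hi', z, hz, .inr ?_⟩
        rcases hb with rfl | ⟨L, hL, hLc, ⟨u, hu, hzu⟩, hbL⟩
        · exact ⟨{c}, by simpa using hcD, Conn.singleton c, ⟨c, rfl, hbc.1⟩, rfl⟩
        · exact ⟨L ∪ {c}, Set.union_subset hL (by simpa using hcD),
            hLc.union (Conn.singleton c) ⟨b, hbL, c, rfl, .inr hbc.1⟩, ⟨u, .inl hu, hzu⟩, .inr rfl⟩
  obtain ⟨i', hi', z, hz, h | ⟨L, hL, -, -, hyL⟩⟩ := key _ (hC.2 _ hxC _ hyC)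
  · rw [huniq j i' z (h ▸ ⟨y, hy, rfl⟩) hz.1]
    exact hi'
  · exact ((hL hyL).2 (Set.mem_iUnion.2 ⟨j, y, hy, rfl⟩)).elim

/-- The number of rows needed to find a wall. -/
def rowBound (r : ℕ) : ℕ := (r + 1) ^ r + 1

open Classical in
/-- The number of aligned columns needed to find a wall. -/
noncomputable def slabBound (r : ℕ) : ℕ :=
  Fintype.card (Fin (rowBound r) → Fin (rowBound r) → Prop) * (2 * r * r) + 1

open Classical in
lemma hasMinor_wall_of_aligned {V : Type} {Γ : SimpleGraph V} {r : ℕ} (hr : 0 < r)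
    (ρ : Fin (rowBound r) → ℕ → V) (N : Fin (rowBound r) → ℕ) (α : Fin (rowBound r) → ℕ → ℕ)
    (C : ℕ → Set V)
    (hadj : ∀ a i, i < N a → Γ.Adj (ρ a i) (ρ a (i + 1)))
    (hinj : ∀ a a' i i', i ≤ N a → i' ≤ N a' → ρ a i = ρ a' i' → a = a' ∧ i = i')
    (hαN : ∀ a, ∀ t ≤ slabBound r, α a t ≤ N a + 1)
    (hC : ∀ t < slabBound r, Conn Γ (C t))
    (hCC : ∀ t < slabBound r, ∀ t' < slabBound r, t ≠ t' → Disjoint (C t) (C t'))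
    (hslab : ∀ t < slabBound r, ∀ a, ∀ i ≤ N a, ρ a i ∈ C t → α a t ≤ i ∧ i < α a (t + 1))
    (hmeet : ∀ t < slabBound r, ∀ a, ∃ i ≤ N a, ρ a i ∈ C t) :
    HasMinor Γ (Wall r) := by
  have hα : ∀ a, ∀ t < slabBound r, α a t < α a (t + 1) := by
    intro a t ht
    obtain ⟨i, hi, hiC⟩ := hmeet t ht a
    have := hslab t ht a i hi hiC
    omega
  obtain ⟨adj, -, hF⟩ := Finset.exists_lt_card_fiber_of_mul_lt_card_of_maps_to
    (s := Finset.range (slabBound r)) (t := (Finset.univ : Finset (Fin (rowBound r) → Fin (rowBound r) → Prop)))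
    (f := fun t => (rowGraph Γ ρ N (C t)).Adj) (n := 2 * r * r) (fun _ _ => Finset.mem_univ _)
    (by rw [Finset.card_univ, Finset.card_range]; exact Nat.lt_succ_self _)
  obtain ⟨e, heF, helt⟩ := exists_increasing_enumeration _ (Nat.succ_le_of_lt hF)
  have heT : ∀ t ≤ 2 * r * r, e t < slabBound r := fun t ht => by
    have := heF t (by omega); simp at this; exact this.1
  have headj : ∀ t ≤ 2 * r * r, (rowGraph Γ ρ N (C (e t))).Adj = adj := fun t ht => by
    have := heF t (by omega); simp at this; exact this.2
  have hr0 : (rowBound r) ≠ 0 := Nat.succ_ne_zero _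
  have : Nonempty (Fin (rowBound r)) := ⟨⟨0, Nat.pos_of_ne_zero hr0⟩⟩
  have hle : ∀ a, ∀ t < 2 * r * r, α a (e t + 1) ≤ α a (e (t + 1)) := fun a t ht =>
    mono_of_lt_succ_le (hα a) (helt t (t + 1) (by omega) (by omega)) (heT _ (by omega)).le
  have hlt : ∀ a, ∀ t < 2 * r * r, α a (e t) < α a (e (t + 1)) := fun a t ht =>
    (hα a _ (heT t ht.le)).trans_le (hle a t ht)
  have hseg : ∀ a, ∀ t < 2 * r * r, rowSet ρ N a ∩ C (e t) ⊆
      ρ a '' Set.Ico (α a (e t)) (α a (e (t + 1))) := by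
    rintro a t ht _ ⟨⟨i, hi, rfl⟩, hiC⟩
    have := hslab _ (heT t ht.le) a i hi hiC
    exact ⟨i, ⟨this.1, this.2.trans_le (hle a t ht)⟩, rfl⟩
  have hsegrow : ∀ a, ∀ t < 2 * r * r, ρ a '' Set.Ico (α a (e t)) (α a (e (t + 1))) ⊆
      rowSet ρ N a := by
    intro a t ht
    refine Set.image_mono fun i hi => ?_
    have := hαN a (e (t + 1)) (heT _ (by omega)).le
    have := hi.2
    simp only [Set.mem_Iic]
    omega
  have hlinked : ∀ t < 2 * r * r, ∀ a a', adj a a' → LinkedIn Γ (C (e t) \ ⋃ k, rowSet ρ N k)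
      (ρ a '' Set.Ico (α a (e t)) (α a (e (t + 1))))
      (ρ a' '' Set.Ico (α a' (e t)) (α a' (e (t + 1)))) := by
    intro t ht a a' h
    rw [← headj t ht.le] at h
    exact h.2.mono subset_rfl (hseg a t ht) (hseg a' t ht)
  have hDD : ∀ t < 2 * r * r, ∀ t' < 2 * r * r, t ≠ t' →
      Disjoint (C (e t) \ ⋃ k, rowSet ρ N k) (C (e t') \ ⋃ k, rowSet ρ N k) := by
    intro t ht t' ht' htt
    refine (hCC _ (heT t ht.le) _ (heT t' ht'.le) ?_).mono Set.sdiff_subset Set.sdiff_subset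
    rcases htt.lt_or_gt with h | h
    · exact (helt _ _ h (by omega)).ne
    · exact (helt _ _ h (by omega)).ne'
  obtain ⟨v, hv, hvadj⟩ | ⟨c, v, hv, hvadj⟩ := exists_path_or_star (rowGraph Γ ρ N (C (e 0)))
    (rowGraph_connected (hC _ (heT 0 (Nat.zero_le _))) hinj (hmeet _ (heT 0 (Nat.zero_le _)))) r
    (by rw [Fintype.card_fin]; exact Nat.lt_succ_self _)
  · refine hasMinor_wall_of_grid hr (fun a => ρ (v a)) (fun a => N (v a))
      (fun a t => α (v a) (e t)) (fun t => C (e t) \ ⋃ k, rowSet ρ N k) (fun a => hadj (v a)) ?_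
      (fun a => hlt (v a)) (fun a t ht => hαN _ _ (heT t ht).le) hDD ?_ ?_
    · intro a a' i i' hi hi' h
      obtain ⟨h1, h2⟩ := hinj _ _ _ _ hi hi' h
      exact ⟨hv h1, h2⟩
    · intro t _ a i hi h
      exact h.2 (Set.mem_iUnion.2 ⟨v a, i, hi, rfl⟩)
    · intro t ht a a' haa
      refine hlinked t ht _ _ ?_
      rw [← headj 0 (Nat.zero_le _)]
      exact hvadj a a' haa
  · have hvc : ∀ a, v a ≠ c := fun a h => (hvadj a).1 h.symm
    refine hasMinor_wall_of_grid hr (fun a => ρ (v a)) (fun a => N (v a))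
      (fun a t => α (v a) (e t)) (fun t => (C (e t) \ ⋃ k, rowSet ρ N k) ∪
        ρ c '' Set.Ico (α c (e t)) (α c (e (t + 1)))) (fun a => hadj (v a)) ?_
      (fun a => hlt (v a)) (fun a t ht => hαN _ _ (heT t ht).le) ?_ ?_ ?_
    · intro a a' i i' hi hi' h
      obtain ⟨h1, h2⟩ := hinj _ _ _ _ hi hi' h
      exact ⟨hv h1, h2⟩
    · intro t ht t' ht' htt
      have hrow : ∀ t < 2 * r * r, ∀ t' < 2 * r * r, Disjoint (C (e t) \ ⋃ k, rowSet ρ N k)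
          (ρ c '' Set.Ico (α c (e t')) (α c (e (t' + 1)))) := by
        intro t ht t' ht'
        rw [Set.disjoint_left]
        intro z hz hz'
        exact hz.2 (Set.mem_iUnion.2 ⟨c, hsegrow c t' ht' hz'⟩)
      simp only [Set.disjoint_union_left, Set.disjoint_union_right]
      refine ⟨⟨hDD t ht t' ht' htt, (hrow t' ht' t ht).symm⟩, hrow t ht t' ht', ?_⟩
      rw [Set.disjoint_left]
      rintro _ ⟨i, hi, rfl⟩ ⟨j, hj, hij⟩
      have h1 := hαN c (e (t + 1)) (heT _ (by omega)).le
      have h2 := hαN c (e (t' + 1)) (heT _ (by omega)).le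
      rw [Set.mem_Ico] at hi hj
      obtain rfl := (hinj c c j i (by omega) (by omega) hij).2
      rcases htt.lt_or_gt with h | h
      · have := mono_of_lt_succ_le (T := 2 * r * r) (α := fun t => α c (e t)) (hlt c)
          (s := t + 1) h (by omega)
        omega
      · have := mono_of_lt_succ_le (T := 2 * r * r) (α := fun t => α c (e t)) (hlt c)
          (s := t' + 1) h (by omega)
        omega
    · rintro t ht a i hi (h | h)
      · exact h.2 (Set.mem_iUnion.2 ⟨v a, i, hi, rfl⟩)
      · obtain ⟨j, hj, hij⟩ := hsegrow c t ht h
        exact hvc a (hinj _ _ _ _ hj hi hij).1.symm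
    · intro t ht a a' _
      have hca : ∀ a, adj c (v a) := fun a => by
        rw [← headj 0 (Nat.zero_le _)]; exact hvadj a
      refine LinkedIn.trans (Conn.image_interval (hlt c t ht) ?_) (hlinked t ht _ _ (hca a)).symm
        (hlinked t ht _ _ (hca a'))
      intro i _ hi
      have h1 := hαN c (e (t + 1)) (heT _ (by omega)).le
      exact hadj c i (by omega)

/-- The edges of a linkage that do not lie inside a column. -/
def crossing {V J ι : Type} {E : V → V → Prop} {X Y : J → Set V} (C : ι → Set V)
    (P : Linkage E X Y) : Set (V × V) :=
  {e | (∃ j, ∃ i < P.n j, e = (P.p j i, P.p j (i + 1))) ∧ ¬ ∃ s, e.1 ∈ C s ∧ e.2 ∈ C s}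

lemma exists_crossing_minimal {V J ι : Type} {E : V → V → Prop} {X Y : J → Set V}
    (C : ι → Set V) (h : Nonempty (Linkage E X Y)) :
    ∃ P : Linkage E X Y, ∀ Q : Linkage E X Y, (crossing C P).ncard ≤ (crossing C Q).ncard := by
  obtain ⟨P, -, hP⟩ := (measure fun P : Linkage E X Y => (crossing C P).ncard).wf.has_min Set.univ
    (by obtain ⟨P⟩ := h; exact ⟨P, trivial⟩)
  exact ⟨P, fun Q => not_lt.1 (hP Q trivial)⟩

open Classical in
lemma exists_cut {V ι : Type} [Finite V] {Γ : SimpleGraph V} {k : ℕ} {X Y : Set V}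
    (C : ι → Set V) (hC : ∀ s, Conn Γ (C s))
    (P : Linkage Γ.Adj (fun _ : Fin k => X) (fun _ => Y))
    (hmin : ∀ Q : Linkage Γ.Adj (fun _ : Fin k => X) (fun _ => Y),
      (crossing C P).ncard ≤ (crossing C Q).ncard)
    (i₀ : Fin k) (ε : ℕ) (hε : ε < P.n i₀)
    (hcross : ¬ ∃ s, P.p i₀ ε ∈ C s ∧ P.p i₀ (ε + 1) ∈ C s) :
    ∃ (S : Finset V) (A : Set V) (γ : Fin k → ℕ), S.card < k ∧ γ i₀ = ε + 1 ∧
      (∀ j, γ j ≤ P.n j + 1) ∧ (∀ j, ∀ i ≤ P.n j, P.p j i ∈ A ↔ i < γ j) ∧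
      ∀ s, Disjoint (C s) S → ∀ x ∈ C s, ∀ y ∈ C s, x ∈ A → y ∈ A := by
  let E : V → V → Prop := fun a b =>
    ((∃ j, ∃ i < P.n j, a = P.p j i ∧ b = P.p j (i + 1)) ∨
      (Γ.Adj a b ∧ ∃ s, a ∈ C s ∧ b ∈ C s)) ∧ ¬ (a = P.p i₀ ε ∧ b = P.p i₀ (ε + 1))
  have hE : ∀ a b, E a b → Γ.Adj a b := by
    rintro a b ⟨⟨j, i, hi, rfl, rfl⟩ | h, -⟩
    · exact P.adj j i hi
    · exact h.1
  have hEp : ∀ j, ∀ i < P.n j, (j ≠ i₀ ∨ i ≠ ε) → E (P.p j i) (P.p j (i + 1)) := by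
    rintro j i hi hne
    refine ⟨.inl ⟨j, i, hi, rfl, rfl⟩, fun h => ?_⟩
    obtain ⟨h1, h2⟩ := P.inj _ _ _ _ hi.le hε.le h.1
    tauto
  have hno : ¬ Nonempty (Linkage E (fun _ : Fin k => X) (fun _ => Y)) := by
    rintro ⟨Q⟩
    refine absurd (hmin ⟨Q.n, Q.p, Q.start, Q.finish, fun j i hi => hE _ _ (Q.adj j i hi), Q.inj⟩)
      (not_le.2 (Set.ncard_lt_ncard ?_ (Set.toFinite _)))
    constructor
    · rintro _ ⟨⟨j, i, hi, rfl⟩, he⟩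
      refine ⟨?_, he⟩
      obtain ⟨⟨j', i', hi', h1, h2⟩ | h, -⟩ := Q.adj j i hi
      · exact ⟨j', i', hi', Prod.ext h1 h2⟩
      · exact absurd h.2 he
    · intro hsub
      obtain ⟨⟨j, i, hi, he⟩, -⟩ := hsub
        (show (P.p i₀ ε, P.p i₀ (ε + 1)) ∈ crossing C P from ⟨⟨i₀, ε, hε, rfl⟩, hcross⟩)
      exact (Q.adj j i hi).2 ⟨(congrArg Prod.fst he).symm, (congrArg Prod.snd he).symm⟩
  have hmenger : ∃ S : Finset V, (∀ y ∈ Y, y ∉ ReachAvoid E X S) ∧ S.card < k := by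
    by_contra hcon
    push Not at hcon
    exact hno (menger E X Y k hcon)
  obtain ⟨S, hS, hSk⟩ := hmenger
  have hmeet : ∀ j, j ≠ i₀ → ∃ i ≤ P.n j, P.p j i ∈ S := by
    intro j hj
    by_contra hcon
    push Not at hcon
    exact hS _ (P.finish j) (ReachAvoid.along (Nat.zero_le _)
      (ReachAvoid.of_mem (P.start j) (hcon 0 (Nat.zero_le _)))
      (fun i _ hi => hEp j i hi (.inl hj)) fun i _ hi => hcon i hi)
  have hσ : ∀ j, ∃ i, j ≠ i₀ → i ≤ P.n j ∧ P.p j i ∈ S := by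
    intro j
    by_cases hj : j = i₀
    · exact ⟨0, fun h => absurd hj h⟩
    · obtain ⟨i, hi⟩ := hmeet j hj
      exact ⟨i, fun _ => hi⟩
  choose σ hσ using hσ
  have hSeq : (Finset.univ.erase i₀).image (fun j => P.p j (σ j)) = S := by
    refine Finset.eq_of_subset_of_card_le ?_ ?_
    · intro v hv
      obtain ⟨j, hj, rfl⟩ := Finset.mem_image.1 hv
      exact (hσ j (Finset.ne_of_mem_erase hj)).2
    · rw [Finset.card_image_of_injOn, Finset.card_erase_of_mem (Finset.mem_univ _),
        Finset.card_univ, Fintype.card_fin]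
      · omega
      · intro j hj j' hj' h
        exact (P.inj _ _ _ _ (hσ j (Finset.ne_of_mem_erase hj)).1
          (hσ j' (Finset.ne_of_mem_erase hj')).1 h).1
  have hSmem : ∀ j, ∀ i ≤ P.n j, P.p j i ∈ S → j ≠ i₀ ∧ i = σ j := by
    intro j i hi h
    rw [← hSeq] at h
    obtain ⟨j', hj', h⟩ := Finset.mem_image.1 h
    have hne := Finset.ne_of_mem_erase hj'
    obtain ⟨rfl, h2⟩ := P.inj _ _ _ _ (hσ j' hne).1 hi h
    exact ⟨hne, h2.symm⟩
  refine ⟨S, ReachAvoid E X S, fun j => if j = i₀ then ε + 1 else σ j, hSk, by simp, ?_, ?_, ?_⟩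
  · intro j
    dsimp only
    split_ifs with h
    · subst h; omega
    · have := (hσ j h).1; omega
  · intro j i hi
    dsimp only
    constructor
    · intro hA
      by_contra hlt
      refine hS _ (P.finish j) (ReachAvoid.along hi hA (fun l hl hl' => hEp j l hl' ?_) ?_)
      · split_ifs at hlt with h
        · right; omega
        · exact .inl h
      · intro l hl hl' h
        obtain ⟨h1, h2⟩ := hSmem j l hl' h
        rw [if_neg h1] at hlt
        omega
    · intro hlt
      have hav : ∀ l ≤ i, P.p j l ∉ S := by
        intro l hl h
        obtain ⟨h1, h2⟩ := hSmem j l (by omega) h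
        rw [if_neg h1] at hlt
        omega
      refine ReachAvoid.along (Nat.zero_le _) (ReachAvoid.of_mem (P.start j) (hav 0 (by omega)))
        (fun l _ hl' => hEp j l (by omega) ?_) fun l _ hl => hav l hl
      split_ifs at hlt with h
      · right; omega
      · exact .inl h
  · intro s hs x hx y hy hxA
    refine (hC s).subset_or_disjoint (fun a ha b hb hab haA => ?_) hx hy hxA
    refine ReachAvoid.step haA ⟨.inr ⟨hab, s, ha, hb⟩, ?_⟩ (Set.disjoint_left.1 hs hb)
    rintro ⟨rfl, rfl⟩
    exact hcross ⟨s, ha, hb⟩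

/-- The number of columns needed to find a wall next to a linkage of `k` paths. -/
noncomputable def colBound (r k : ℕ) : ℕ := (slabBound r + 2) * ((slabBound r + 1) * k + 1)

open Classical in
/-- A crossing-minimal linkage, sufficiently many paths of which meet sufficiently many common
columns, gives rise to a wall. -/
lemma hasMinor_wall_of_crossing_minimal {V ι : Type} [Finite V] {Γ : SimpleGraph V} {r k : ℕ}
    (hr : 0 < r) {X Y : Set V} (C : ι → Set V) (hC : ∀ s, Conn Γ (C s))
    (hCC : ∀ s s', s ≠ s' → Disjoint (C s) (C s'))
    (P : Linkage Γ.Adj (fun _ : Fin k => X) (fun _ => Y))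
    (hmin : ∀ Q : Linkage Γ.Adj (fun _ : Fin k => X) (fun _ => Y),
      (crossing C P).ncard ≤ (crossing C Q).ncard)
    (rows : Fin (rowBound r) → Fin k) (hrows : Function.Injective rows)
    (J : Finset ι) (hJ : colBound r k ≤ J.card)
    (hmeet : ∀ s ∈ J, ∀ a, ∃ i ≤ P.n (rows a), P.p (rows a) i ∈ C s) :
    HasMinor Γ (Wall r) := by
  set T := slabBound r with hT
  set m := (T + 1) * k + 1 with hm
  let i₀ : Fin k := rows ⟨0, Nat.succ_pos _⟩
  have hk : 0 < k := i₀.pos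
  have hmeet0 : ∀ s, ∃ i, s ∈ J → i ≤ P.n i₀ ∧ P.p i₀ i ∈ C s ∧
      ∀ i' < i, P.p i₀ i' ∉ C s := by
    intro s
    by_cases hs : s ∈ J
    · have hex := hmeet s hs ⟨0, Nat.succ_pos _⟩
      refine ⟨Nat.find hex, fun _ => ⟨(Nat.find_spec hex).1, (Nat.find_spec hex).2, ?_⟩⟩
      intro i' hi' h
      exact Nat.find_min hex hi' ⟨by have := (Nat.find_spec hex).1; omega, h⟩
    · exact ⟨0, fun h => absurd h hs⟩
  choose h hh using hmeet0
  have hCeq : ∀ s s' v, v ∈ C s → v ∈ C s' → s = s' := by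
    intro s s' v hv hv'
    by_contra hne
    exact Set.disjoint_left.1 (hCC s s' hne) hv hv'
  have hinj : Set.InjOn h J := by
    intro s hs s' hs' he
    refine hCeq s s' _ (hh s hs).2.1 ?_
    rw [he]
    exact (hh s' hs').2.1
  obtain ⟨e, heJ, helt⟩ := exists_increasing_enumeration (J.image h) (m := (T + 2) * m)
    (by rw [Finset.card_image_of_injOn hinj]; exact hJ)
  have hc : ∀ t, ∃ s, t < (T + 2) * m → s ∈ J ∧ h s = e t := by
    intro t
    by_cases ht : t < (T + 2) * m
    · obtain ⟨s, hs, hse⟩ := Finset.mem_image.1 (heJ t ht)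
      exact ⟨s, fun _ => ⟨hs, hse⟩⟩
    · obtain ⟨s, hs⟩ := Finset.card_pos.1
        (lt_of_lt_of_le (Nat.mul_pos (Nat.succ_pos _) (Nat.succ_pos _)) hJ)
      exact ⟨s, fun h => absurd h ht⟩
  choose c hc using hc
  have hele : ∀ s t, s ≤ t → t < (T + 2) * m → e s ≤ e t := by
    intro s t hst ht
    rcases hst.eq_or_lt with rfl | hst
    · exact le_rfl
    · exact (helt s t hst ht).le
  have hmT : ∀ t ≤ T, (t + 1) * m < (T + 2) * m := fun t ht =>
    Nat.mul_lt_mul_of_pos_right (by omega) (by omega)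
  have hcut : ∀ t ≤ T, ∃ ε < P.n i₀, e ((t + 1) * m - 1) ≤ ε ∧ ε < e ((t + 1) * m) ∧
      ¬ ∃ s, P.p i₀ ε ∈ C s ∧ P.p i₀ (ε + 1) ∈ C s := by
    intro t ht
    have hpos : 0 < (t + 1) * m := by positivity
    have h1 := hc _ (hmT t ht)
    have h2 := hc ((t + 1) * m - 1) (by have := hmT t ht; omega)
    have hlt := helt ((t + 1) * m - 1) ((t + 1) * m) (by omega) (hmT t ht)
    have h3 := hh _ h1.1
    have h4 := hh _ h2.1
    rw [h1.2] at h3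
    rw [h2.2] at h4
    by_contra hcon
    push Not at hcon
    have key : ∀ i, e ((t + 1) * m - 1) ≤ i → i ≤ e ((t + 1) * m) →
        P.p i₀ i ∈ C (c ((t + 1) * m - 1)) := by
      intro i hi
      induction i, hi using Nat.le_induction with
      | base => exact fun _ => h4.2.1
      | succ i hi ih =>
        intro hle
        obtain ⟨s, hs1, hs2⟩ := hcon i (by omega) hi (by omega)
        rwa [hCeq _ _ _ (ih (by omega)) hs1]
    have heq := hCeq _ _ _ (key _ hlt.le le_rfl) h3.2.1
    rw [← h1.2, ← h2.2, heq] at hlt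
    exact lt_irrefl _ hlt
  have hsep : ∀ t, ∃ (S : Finset V) (A : Set V) (γ : Fin k → ℕ), t ≤ T → S.card < k ∧
      e ((t + 1) * m - 1) < γ i₀ ∧ γ i₀ ≤ e ((t + 1) * m) ∧
      (∀ j, γ j ≤ P.n j + 1) ∧ (∀ j, ∀ i ≤ P.n j, P.p j i ∈ A ↔ i < γ j) ∧
      ∀ s, Disjoint (C s) S → ∀ x ∈ C s, ∀ y ∈ C s, x ∈ A → y ∈ A := by
    intro t
    by_cases ht : t ≤ T
    · obtain ⟨ε, hεn, hε1, hε2, hε3⟩ := hcut t ht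
      obtain ⟨S, A, γ, h1, h2, h3⟩ := exists_cut C hC P hmin i₀ ε hεn hε3
      exact ⟨S, A, γ, fun _ => ⟨h1, by omega, by omega, h3⟩⟩
    · exact ⟨∅, ∅, 0, fun h => absurd h ht⟩
  choose S A γ hsep using hsep
  have hgood : ∀ t, ∃ l, t < T → (t + 1) * m ≤ l ∧ l < (t + 2) * m ∧
      ∀ t' ≤ T, Disjoint (C (c l)) (S t' : Set V) := by
    intro t
    by_cases ht : t < T
    swap
    · exact ⟨0, fun h => absurd h ht⟩
    by_contra hcon
    have hbad : ∀ l : ℕ, ∃ v, (t + 1) * m ≤ l → l < (t + 2) * m →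
        v ∈ C (c l) ∧ v ∈ (Finset.range (T + 1)).biUnion S := by
      intro l
      by_cases hl : (t + 1) * m ≤ l ∧ l < (t + 2) * m
      · by_contra hne
        push Not at hne
        refine hcon ⟨l, fun _ => ⟨hl.1, hl.2, fun t' ht' => ?_⟩⟩
        rw [Set.disjoint_left]
        intro v hv hvS
        obtain ⟨-, -, h3⟩ := hne v
        exact h3 hv (Finset.mem_biUnion.2 ⟨t', by simpa using Nat.lt_succ_of_le ht', hvS⟩)
      · exact ⟨P.p i₀ 0, fun h1 h2 => absurd ⟨h1, h2⟩ hl⟩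
    choose v hv using hbad
    have hTm : (t + 2) * m ≤ (T + 2) * m := Nat.mul_le_mul_right _ (by omega)
    have hcard : ((Finset.Ico ((t + 1) * m) ((t + 2) * m)).image v).card = m := by
      rw [Finset.card_image_of_injOn, Nat.card_Ico]
      · rw [← Nat.sub_mul]; simp
      · intro l hl l' hl' he
        rw [Finset.mem_coe, Finset.mem_Ico] at hl hl'
        have h1 := hv l hl.1 hl.2
        have h2 := hv l' hl'.1 hl'.2
        have h3 := hCeq _ _ _ h1.1 (he ▸ h2.1)
        have h4 := (hc l (by omega)).2
        rw [h3, (hc l' (by omega)).2] at h4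
        by_contra hne
        rcases Nat.lt_or_gt_of_ne hne with hlt | hlt
        · have := helt l l' hlt (by omega); omega
        · have := helt l' l hlt (by omega); omega
    have hle : ((Finset.Ico ((t + 1) * m) ((t + 2) * m)).image v).card ≤
        ((Finset.range (T + 1)).biUnion S).card := by
      refine Finset.card_le_card fun w hw => ?_
      obtain ⟨l, hl, rfl⟩ := Finset.mem_image.1 hw
      rw [Finset.mem_Ico] at hl
      exact (hv l hl.1 hl.2).2
    have hle2 : ((Finset.range (T + 1)).biUnion S).card ≤ (Finset.range (T + 1)).card * k :=
      Finset.card_biUnion_le_card_mul _ _ _ fun t' ht' =>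
        (hsep t' (by simp at ht'; omega)).1.le
    rw [Finset.card_range] at hle2
    omega
  choose l hl using hgood
  have hlT : ∀ t < T, l t < (T + 2) * m := fun t ht =>
    (hl t ht).2.1.trans_le (Nat.mul_le_mul_right _ (by omega))
  have hlJ : ∀ t < T, c (l t) ∈ J := fun t ht => (hc _ (hlT t ht)).1
  refine hasMinor_wall_of_aligned hr (fun a => P.p (rows a)) (fun a => P.n (rows a))
    (fun a t => γ t (rows a)) (fun t => C (c (l t))) (fun a => P.adj (rows a)) ?_
    (fun a t ht => (hsep t ht).2.2.2.1 (rows a)) (fun t _ => hC _) ?_ ?_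
    (fun t ht a => hmeet _ (hlJ t ht) a)
  · intro a a' i i' hi hi' he
    obtain ⟨h1, h2⟩ := P.inj _ _ _ _ hi hi' he
    exact ⟨hrows h1, h2⟩
  · intro t ht t' ht' hne
    refine hCC _ _ fun he => ?_
    have h1 := (hc _ (hlT t ht)).2
    rw [he, (hc _ (hlT t' ht')).2] at h1
    have h2 := hl t ht
    have h3 := hl t' ht'
    rcases Nat.lt_or_gt_of_ne hne with hlt | hlt
    · have h4 : (t + 2) * m ≤ (t' + 1) * m := Nat.mul_le_mul_right _ (by omega)
      have := helt (l t) (l t') (by omega) (hlT t' ht')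
      omega
    · have h4 : (t' + 2) * m ≤ (t + 1) * m := Nat.mul_le_mul_right _ (by omega)
      have := helt (l t') (l t) (by omega) (hlT t ht)
      omega
  · intro t ht a i hi hiC
    obtain ⟨hl1, hl2, hl3⟩ := hl t ht
    have hbase := hh _ (hlJ t ht)
    rw [(hc _ (hlT t ht)).2] at hbase
    obtain ⟨-, -, hs3, -, hs5, hs6⟩ := hsep t ht.le
    obtain ⟨-, hs2', -, -, hs5', hs6'⟩ := hsep (t + 1) ht
    constructor
    · by_contra hlt
      have hA := (hs5 (rows a) i hi).2 (by omega)
      have hA' := hs6 _ (hl3 t ht.le) _ hiC _ hbase.2.1 hA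
      have h1 := (hs5 i₀ _ hbase.1).1 hA'
      have h2 := hele _ _ hl1 (hlT t ht)
      omega
    · have h2 : e (l t) ≤ e ((t + 1 + 1) * m - 1) :=
        hele _ _ (by rw [show t + 1 + 1 = t + 2 by omega]; omega)
          (by have := hmT (t + 1) ht; omega)
      have hA' := (hs5' i₀ _ hbase.1).2 (by omega)
      exact (hs5' (rows a) i hi).1 (hs6' _ (hl3 (t + 1) ht) _ hbase.2.1 _ hiC hA')

/-- The spanning subgraph consisting of the edges with both ends in `D`. -/
def edgesWithin {V : Type} (Γ : SimpleGraph V) (D : Set V) : SimpleGraph V where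
  Adj := AdjIn Γ D
  symm := ⟨fun _ _ h => h.symm⟩
  loopless := ⟨fun _ h => h.1.ne rfl⟩

lemma edgesWithin_le {V : Type} (Γ : SimpleGraph V) (D : Set V) : edgesWithin Γ D ≤ Γ :=
  fun _ _ h => h.1

/-- The linkage formed by some of the paths of a linkage, all of which stay within `D`. -/
def Linkage.restrict {V I J : Type} {Γ : SimpleGraph V} {X Y : J → Set V} (P : Linkage Γ.Adj X Y)
    (f : I → J) (hf : Function.Injective f) (D : Set V)
    (hD : ∀ j, ∀ i ≤ P.n (f j), P.p (f j) i ∈ D) :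
    Linkage (edgesWithin Γ D).Adj (fun j => X (f j) ∩ D) (fun j => Y (f j) ∩ D) where
  n j := P.n (f j)
  p j := P.p (f j)
  start j := ⟨P.start _, hD j _ (Nat.zero_le _)⟩
  finish j := ⟨P.finish _, hD j _ le_rfl⟩
  adj j i hi := ⟨P.adj _ i hi, hD j _ hi.le, hD j _ hi⟩
  inj _ _ _ _ hi hi' h := ⟨hf (P.inj _ _ _ _ hi hi' h).1, (P.inj _ _ _ _ hi hi' h).2⟩

/-- The linkage formed by some of the paths of a linkage. -/
def Linkage.comp {V I J : Type} {E : V → V → Prop} {X Y : J → Set V} (P : Linkage E X Y)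
    (f : I → J) (hf : Function.Injective f) :
    Linkage E (fun j => X (f j)) (fun j => Y (f j)) where
  n j := P.n (f j)
  p j := P.p (f j)
  start _ := P.start _
  finish _ := P.finish _
  adj _ i hi := P.adj _ i hi
  inj _ _ _ _ hi hi' h := ⟨hf (P.inj _ _ _ _ hi hi' h).1, (P.inj _ _ _ _ hi hi' h).2⟩

lemma Linkage.mem_of_within {V J : Type} {Γ : SimpleGraph V} {D : Set V} {X Y : J → Set V}
    (P : Linkage (edgesWithin Γ D).Adj X Y) (hX : ∀ j, X j ⊆ D) (j : J) :
    ∀ i ≤ P.n j, P.p j i ∈ D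
  | 0, _ => hX j (P.start j)
  | i + 1, hi => (P.adj j i hi).2.2

lemma Linkage.conn {V J : Type} {Γ : SimpleGraph V} {X Y : J → Set V} (P : Linkage Γ.Adj X Y)
    (j : J) : Conn Γ (P.p j '' Set.Ico 0 (P.n j + 1)) :=
  Conn.image_interval (Nat.succ_pos _) fun i _ hi => P.adj j i (by omega)

open Classical in
/-- The paths of a linkage that meet `s`. -/
noncomputable def hits {V : Type} {k : ℕ} {E : V → V → Prop} {X Y : Fin k → Set V}
    (P : Linkage E X Y) (s : Set V) : Finset (Fin k) :=
  Finset.univ.filter fun a => ∃ i ≤ P.n a, P.p a i ∈ s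

lemma mem_hits {V : Type} {k : ℕ} {E : V → V → Prop} {X Y : Fin k → Set V}
    {P : Linkage E X Y} {s : Set V} {a : Fin k} :
    a ∈ hits P s ↔ ∃ i ≤ P.n a, P.p a i ∈ s := by
  simp [hits]

open Classical in
lemma hasMinor_wall_of_many_hits {V ι I : Type} [Finite V] [Fintype I] {Γ : SimpleGraph V}
    {r k : ℕ} (hr : 0 < r) {X Y : I → Set V} (C : ι → Set V) (hC : ∀ s, Conn Γ (C s))
    (hCC : ∀ s s', s ≠ s' → Disjoint (C s) (C s'))
    (P : ∀ e, Linkage Γ.Adj (fun _ : Fin k => X e) (fun _ => Y e))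
    (hmin : ∀ e, ∀ Q : Linkage Γ.Adj (fun _ : Fin k => X e) (fun _ => Y e),
      (crossing C (P e)).ncard ≤ (crossing C Q).ncard)
    (J : Finset ι) (hJ : Fintype.card I * k ^ rowBound r * colBound r k < J.card)
    (hits_le : ∀ s ∈ J, ∃ e, rowBound r ≤ (hits (P e) (C s)).card) :
    HasMinor Γ (Wall r) := by
  have hsel : ∀ s, ∃ c : I × (Fin (rowBound r) → Fin k), s ∈ J →
      Function.Injective c.2 ∧ ∀ a, c.2 a ∈ hits (P c.1) (C s) := by
    intro s
    by_cases hs : s ∈ J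
    · obtain ⟨e, he⟩ := hits_le s hs
      obtain ⟨T, hT, hTc⟩ := Finset.exists_subset_card_eq he
      refine ⟨⟨e, fun a => T.orderEmbOfFin hTc a⟩, fun _ => ⟨?_, fun a => hT ?_⟩⟩
      · exact (T.orderEmbOfFin hTc).injective
      · exact Finset.orderEmbOfFin_mem T hTc a
    · obtain ⟨s', hs'⟩ := Finset.card_pos.1 ((Nat.zero_le _).trans_lt hJ)
      obtain ⟨e, he⟩ := hits_le s' hs'
      obtain ⟨a, -⟩ := Finset.card_pos.1 (lt_of_lt_of_le (Nat.succ_pos _) he)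
      exact ⟨⟨e, fun _ => a⟩, fun h => absurd h hs⟩
  choose c hc using hsel
  obtain ⟨⟨e, rows⟩, -, hlt⟩ := Finset.exists_lt_card_fiber_of_mul_lt_card_of_maps_to
    (s := J) (t := Finset.univ) (f := c) (n := colBound r k) (fun _ _ => Finset.mem_univ _)
    (by simpa using hJ)
  obtain ⟨s₀, hs₀⟩ := Finset.card_pos.1 ((Nat.zero_le _).trans_lt hlt)
  rw [Finset.mem_filter] at hs₀
  have hinj := (hc s₀ hs₀.1).1
  rw [hs₀.2] at hinj
  refine hasMinor_wall_of_crossing_minimal hr C hC hCC (P e) (hmin e) rows hinj _ hlt.le ?_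
  intro s hs a
  rw [Finset.mem_filter] at hs
  have := (hc s hs.1).2 a
  rw [hs.2] at this
  exact mem_hits.1 this

lemma exists_injection_avoiding {k : ℕ} (F : Finset (Fin k)) {m : ℕ} (h : m + F.card ≤ k) :
    ∃ f : Fin m → Fin k, Function.Injective f ∧ ∀ a, f a ∉ F := by
  have : m ≤ (Finset.univ \ F).card := by
    rw [Finset.card_sdiff_of_subset (Finset.subset_univ _), Finset.card_univ, Fintype.card_fin]
    omega
  obtain ⟨T, hT, hTc⟩ := Finset.exists_subset_card_eq this
  refine ⟨fun a => T.orderEmbOfFin hTc a, (T.orderEmbOfFin hTc).injective, fun a => ?_⟩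
  exact (Finset.mem_sdiff.1 (hT (Finset.orderEmbOfFin_mem T hTc a))).2

lemma exists_linkage_bound_fin {r : ℕ} (hr : 0 < r) (n : ℕ) : ∃ K : ℕ,
    ∀ (V : Type) [Finite V] (Γ : SimpleGraph V) (X Y : Fin n → Set V),
      (∀ e, Nonempty (Linkage Γ.Adj (fun _ : Fin K => X e) (fun _ => Y e))) →
      HasMinor Γ (Wall r) ∨ Nonempty (Linkage Γ.Adj X Y) := by
  induction n with
  | zero =>
    exact ⟨0, fun V _ Γ X Y _ => .inr ⟨⟨fun _ => 0, fun j => j.elim0, fun j => j.elim0,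
      fun j => j.elim0, fun j => j.elim0, fun j => j.elim0⟩⟩⟩
  | succ n ih =>
    obtain ⟨K, hK⟩ := ih
    set k := K + rowBound r with hk
    refine ⟨n * k ^ rowBound r * colBound r k + 1 + k, fun V _ Γ X Y h => ?_⟩
    obtain ⟨P₀⟩ := h 0
    set C : Fin (n * k ^ rowBound r * colBound r k + 1 + k) → Set V :=
      fun s => P₀.p s '' Set.Ico 0 (P₀.n s + 1) with hCdef
    have hCC : ∀ s s', s ≠ s' → Disjoint (C s) (C s') := by
      intro s s' hne
      rw [Set.disjoint_left]
      rintro _ ⟨i, hi, rfl⟩ ⟨i', hi', he⟩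
      exact hne (P₀.inj _ _ _ _ (Nat.lt_succ_iff.1 hi.2) (Nat.lt_succ_iff.1 hi'.2) he.symm).1
    have hP : ∀ e : Fin n, ∃ P : Linkage Γ.Adj (fun _ : Fin k => X e.succ) (fun _ => Y e.succ),
        ∀ Q : Linkage Γ.Adj (fun _ : Fin k => X e.succ) (fun _ => Y e.succ),
          (crossing C P).ncard ≤ (crossing C Q).ncard := by
      intro e
      obtain ⟨Q⟩ := h e.succ
      exact exists_crossing_minimal C
        ⟨Q.comp (Fin.castLE (by omega)) (Fin.castLE_injective _)⟩
    choose P hmin using hP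
    by_cases hall : ∀ s, ∃ e, rowBound r ≤ (hits (P e) (C s)).card
    · refine .inl (hasMinor_wall_of_many_hits hr C P₀.conn hCC P hmin Finset.univ ?_
        fun s _ => hall s)
      simp only [Fintype.card_fin, Finset.card_univ]
      omega
    · push Not at hall
      obtain ⟨s, hs⟩ := hall
      have hsub : ∀ e : Fin n, Nonempty (Linkage (edgesWithin Γ (C s)ᶜ).Adj
          (fun _ : Fin K => X e.succ ∩ (C s)ᶜ) (fun _ => Y e.succ ∩ (C s)ᶜ)) := by
        intro e
        obtain ⟨f, hf, hfa⟩ := exists_injection_avoiding (hits (P e) (C s)) (m := K)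
          (by have := hs e; omega)
        refine ⟨(P e).restrict f hf _ fun j i hi hmem => hfa j (mem_hits.2 ⟨i, hi, hmem⟩)⟩
      obtain hw | ⟨⟨Q⟩⟩ := hK V (edgesWithin Γ (C s)ᶜ) _ _ hsub
      · exact .inl (hw.mono (edgesWithin_le _ _))
      · have hQ := Q.mem_of_within fun _ => Set.inter_subset_right
        have hmem : ∀ i ≤ P₀.n s, P₀.p s i ∈ C s := fun i hi => ⟨i, ⟨Nat.zero_le _, by omega⟩, rfl⟩
        refine .inr ⟨⟨Fin.cons (P₀.n s) Q.n, Fin.cons (P₀.p s) Q.p, ?_, ?_, ?_, ?_⟩⟩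
        · exact Fin.cases (P₀.start s) fun j => (Q.start j).1
        · exact Fin.cases (P₀.finish s) fun j => (Q.finish j).1
        · exact Fin.cases (P₀.adj s) fun j i hi => (Q.adj j i hi).1
        · refine Fin.cases (Fin.cases ?_ ?_) fun j => Fin.cases ?_ ?_
          · exact fun i i' hi hi' he => ⟨rfl, (P₀.inj s s i i' hi hi' he).2⟩
          · intro j i i' hi hi' he
            simp only [Fin.cons_zero, Fin.cons_succ] at hi hi' he
            exact absurd (he ▸ hmem i hi) (hQ j i' hi')
          · intro i i' hi hi' he
            simp only [Fin.cons_zero, Fin.cons_succ] at hi hi' he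
            exact absurd (he ▸ hmem i' hi') (hQ j i hi)
          · intro j' i i' hi hi' he
            simp only [Fin.cons_succ] at hi hi' he
            obtain ⟨h1, h2⟩ := Q.inj _ _ _ _ hi hi' he
            exact ⟨congrArg _ h1, h2⟩

/-- If each of boundedly many pairs of vertex sets is joined by a large linkage, then there is a
wall minor, or the pairs can be joined simultaneously by disjoint paths. -/
lemma exists_linkage_bound {r : ℕ} (hr : 0 < r) (n : ℕ) : ∃ K : ℕ,
    ∀ (V I : Type) [Finite V] [Fintype I] (Γ : SimpleGraph V) (X Y : I → Set V),
      Fintype.card I ≤ n →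
      (∀ e, Nonempty (Linkage Γ.Adj (fun _ : Fin K => X e) (fun _ => Y e))) →
      HasMinor Γ (Wall r) ∨ Nonempty (Linkage Γ.Adj X Y) := by
  choose K hK using fun n => exists_linkage_bound_fin hr n
  refine ⟨(Finset.range (n + 1)).sup K, fun V I _ _ Γ X Y hI h => ?_⟩
  let g := Fintype.equivFin I
  have hle : K (Fintype.card I) ≤ (Finset.range (n + 1)).sup K :=
    Finset.le_sup (Finset.mem_range.2 (by omega))
  refine (hK _ V Γ (X ∘ g.symm) (Y ∘ g.symm) fun e => ?_).imp id fun ⟨P⟩ => ?_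
  · obtain ⟨P⟩ := h (g.symm e)
    exact ⟨P.comp (Fin.castLE hle) (Fin.castLE_injective _)⟩
  · have := P.comp g g.injective
    simp only [Function.comp_apply, Equiv.symm_apply_apply] at this
    exact ⟨this⟩

open Classical in
lemma sum_update_swap {U α : Type} [Fintype U] [DecidableEq U] [Fintype α] (c : U)
    (F : (U → α) → Finset α) (hF : ∀ g y, F (Function.update g c y) = F g) :
    Fintype.card α * (Finset.univ.filter fun g : U → α => g c ∈ F g).card = ∑ g, (F g).card := by
  have h1 : ∑ g, (F g).card
      = (Finset.univ.filter fun x : (U → α) × α => x.2 ∈ F x.1).card := by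
    rw [Finset.card_filter, Fintype.sum_prod_type]
    refine Finset.sum_congr rfl fun g _ => ?_
    simp
  have h2 : Fintype.card α * (Finset.univ.filter fun g : U → α => g c ∈ F g).card
      = (Finset.univ.filter fun x : (U → α) × α => x.1 c ∈ F x.1).card := by
    rw [Finset.card_filter, Finset.card_filter, Fintype.sum_prod_type, Finset.mul_sum]
    refine Finset.sum_congr rfl fun g _ => ?_
    by_cases h : g c ∈ F g <;> simp [h]
  rw [h1, h2]
  refine Finset.card_bij' (fun x _ => (Function.update x.1 c x.2, x.1 c))
    (fun x _ => (Function.update x.1 c x.2, x.1 c)) ?_ ?_ ?_ ?_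
  · rintro ⟨g, y⟩ h
    simpa [hF] using h
  · rintro ⟨g, y⟩ h
    simpa [hF] using h
  · rintro ⟨g, y⟩ _
    simp
  · rintro ⟨g, y⟩ _
    simp

open Classical in
/-- A function can be chosen to avoid a few lists of few forbidden values each, where the list for
an argument depends on the values of the other arguments. -/
lemma exists_avoiding {U T : Type} [Fintype U] [DecidableEq U] [Fintype T] {f b : ℕ} (c : T → U)
    (F : T → (U → Fin f) → Finset (Fin f))
    (hF : ∀ t g y, F t (Function.update g (c t) y) = F t g) (hcard : ∀ t g, (F t g).card ≤ b)
    (h : Fintype.card T * b < f) : ∃ g : U → Fin f, ∀ t, g (c t) ∉ F t g := by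
  by_contra hcon
  push Not at hcon
  have hpos : 0 < Fintype.card (U → Fin f) := by
    have : Nonempty (U → Fin f) := ⟨fun _ => ⟨0, by omega⟩⟩
    exact Fintype.card_pos
  have h1 : Fintype.card (U → Fin f)
      ≤ ∑ t, (Finset.univ.filter fun g : U → Fin f => g (c t) ∈ F t g).card := by
    rw [← Finset.card_univ]
    refine le_trans (Finset.card_le_card fun g _ => ?_) Finset.card_biUnion_le
    obtain ⟨t, ht⟩ := hcon g
    exact Finset.mem_biUnion.2 ⟨t, Finset.mem_univ _, by simpa using ht⟩
  have h2 : f * Fintype.card (U → Fin f)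
      ≤ Fintype.card T * (Fintype.card (U → Fin f) * b) := by
    calc f * Fintype.card (U → Fin f)
        ≤ f * ∑ t, (Finset.univ.filter fun g : U → Fin f => g (c t) ∈ F t g).card :=
          Nat.mul_le_mul_left _ h1
      _ = ∑ t, ∑ g, (F t g).card := by
          rw [Finset.mul_sum]
          refine Finset.sum_congr rfl fun t _ => ?_
          have := sum_update_swap (c t) (F t) (hF t)
          rw [Fintype.card_fin] at this
          convert this
      _ ≤ ∑ _t : T, ∑ _g : U → Fin f, b :=
          Finset.sum_le_sum fun t _ => Finset.sum_le_sum fun g _ => hcard t g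
      _ = _ := by simp
  have h3 := Nat.mul_lt_mul_of_pos_right h hpos
  have h4 : Fintype.card T * (Fintype.card (U → Fin f) * b)
      = Fintype.card T * b * Fintype.card (U → Fin f) := by ring
  omega

/-- A sequence from `A` to `B` has a subinterval running from `A` to `B` with interior outside. -/
lemma exists_trim {V : Type} {p : ℕ → V} {n : ℕ} {A B : Set V} (hAB : Disjoint A B)
    (h0 : p 0 ∈ A) (hn : p n ∈ B) : ∃ α β, α < β ∧ β ≤ n ∧ p α ∈ A ∧ p β ∈ B ∧
      ∀ i, α < i → i < β → p i ∉ A ∧ p i ∉ B := by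
  classical
  have hex : ∃ i, p i ∈ B := ⟨n, hn⟩
  set β := Nat.find hex with hβ
  have hβB : p β ∈ B := Nat.find_spec hex
  have hα : p (Nat.findGreatest (fun i => p i ∈ A) β) ∈ A :=
    Nat.findGreatest_spec (P := fun i => p i ∈ A) (Nat.zero_le _) h0
  refine ⟨Nat.findGreatest (fun i => p i ∈ A) β, β, ?_, Nat.find_min' hex hn, hα, hβB,
    fun i h1 h2 => ⟨Nat.findGreatest_is_greatest h1 h2.le, Nat.find_min hex h2⟩⟩
  refine lt_of_le_of_ne (Nat.findGreatest_le _) fun he => ?_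
  rw [he] at hα
  exact Set.disjoint_left.1 hAB hα hβB

open Classical in
/-- Disjoint connected rows that all meet each of two sets link these sets. -/
lemma exists_linkage_of_rows {V : Type} [Finite V] {Γ : SimpleGraph V} {k : ℕ}
    (R : Fin k → Set V) (hR : ∀ i, Conn Γ (R i)) (hRR : ∀ i j, i ≠ j → Disjoint (R i) (R j))
    {X Y : Set V} (hX : ∀ i, (R i ∩ X).Nonempty) (hY : ∀ i, (R i ∩ Y).Nonempty) :
    Nonempty (Linkage Γ.Adj (fun _ : Fin k => X) (fun _ => Y)) := by
  refine menger Γ.Adj X Y k fun S hS => ?_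
  have hmeet : ∀ i, ∃ v ∈ S, v ∈ R i := by
    intro i
    by_contra hcon
    push Not at hcon
    obtain ⟨x, hxR, hx⟩ := hX i
    obtain ⟨y, hyR, hy⟩ := hY i
    refine hS y hy ⟨x, hx, fun h => hcon x h hxR, ?_⟩
    exact Relation.ReflTransGen.mono
      (fun a b (h : AdjIn Γ (R i) a b) => ⟨h.1, fun hb => hcon b hb h.2.2⟩) _ _
      ((hR i).2 x hxR y hyR)
  choose v hvS hvR using hmeet
  have : Function.Injective v := by
    intro i j hij
    by_contra hne
    exact Set.disjoint_left.1 (hRR i j hne) (hvR i) (hij ▸ hvR j)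
  simpa using Finset.card_le_card_of_injOn v (s := Finset.univ) (fun i _ => hvS i) this.injOn

open Classical in
/-- If a large linkage joins two non-adjacent hubs and few of its paths meet other hubs, then there
is a large linkage outside the hubs between their neighbourhoods. -/
lemma exists_linkage_outside {V U : Type} [Fintype U] {Γ : SimpleGraph V} {k K b : ℕ}
    (β : U → Set V) {a a' : U} (hdisj : Disjoint (β a) (β a'))
    (hnadj : ∀ x ∈ β a, ∀ y ∈ β a', ¬ Γ.Adj x y)
    (P : Linkage Γ.Adj (fun _ : Fin k => β a) (fun _ => β a'))
    (hb : ∀ c, c ≠ a → c ≠ a' → (hits P (β c)).card ≤ b) (hk : K + Fintype.card U * b ≤ k) :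
    Nonempty (Linkage (edgesWithin Γ (⋃ c, β c)ᶜ).Adj
      (fun _ : Fin K => {z | z ∈ (⋃ c, β c)ᶜ ∧ ∃ x ∈ β a, Γ.Adj x z})
      (fun _ => {z | z ∈ (⋃ c, β c)ᶜ ∧ ∃ x ∈ β a', Γ.Adj z x})) := by
  obtain ⟨h, hh, hav⟩ := exists_injection_avoiding (m := K)
    ((Finset.univ.filter fun c => c ≠ a ∧ c ≠ a').biUnion fun c => hits P (β c)) (by
      refine le_trans (Nat.add_le_add_left (Finset.card_biUnion_le_card_mul _ _ b ?_) _)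
        (le_trans (Nat.add_le_add_left (Nat.mul_le_mul_right _ (Finset.card_filter_le _ _)) _) hk)
      intro c hc
      have := (Finset.mem_filter.1 hc).2
      exact hb c this.1 this.2)
  have hav' : ∀ j c, c ≠ a → c ≠ a' → ∀ i ≤ P.n (h j), P.p (h j) i ∉ β c := by
    intro j c hc hc' i hi hmem
    exact hav j (Finset.mem_biUnion.2 ⟨c, by simp [hc, hc'], mem_hits.2 ⟨i, hi, hmem⟩⟩)
  have htrim := fun j : Fin K => exists_trim hdisj (P.start (h j)) (P.finish (h j))
  choose s t hst htn hs ht hbetween using htrim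
  have hadj1 : ∀ j, s j + 1 < t j := by
    intro j
    refine lt_of_le_of_ne (hst j) fun he => hnadj _ (hs j) _ (ht j) ?_
    rw [← he]
    exact P.adj (h j) (s j) ((hst j).trans_le (htn j))
  have hZ : ∀ j i, s j < i → i < t j → P.p (h j) i ∈ (⋃ c, β c)ᶜ := by
    intro j i h1 h2 hmem
    obtain ⟨c, hc⟩ := Set.mem_iUnion.1 hmem
    by_cases hca : c = a
    · exact (hbetween j i h1 h2).1 (hca ▸ hc)
    · by_cases hca' : c = a'
      · exact (hbetween j i h1 h2).2 (hca' ▸ hc)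
      · exact hav' j c hca hca' i (h2.le.trans (htn j)) hc
  refine ⟨⟨fun j => t j - s j - 2, fun j i => P.p (h j) (s j + 1 + i), ?_, ?_, ?_, ?_⟩⟩
  · intro j
    have := hadj1 j
    refine ⟨hZ j _ (by omega) (by omega), _, hs j, ?_⟩
    exact P.adj (h j) (s j) (by have := htn j; omega)
  · intro j
    have h1 := hadj1 j
    have h2 := htn j
    refine ⟨hZ j _ (by omega) (by omega), _, ht j, ?_⟩
    have := P.adj (h j) (t j - 1) (by omega)
    convert this using 2 <;> omega
  · intro j i hi
    have h2 := htn j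
    exact ⟨P.adj (h j) (s j + 1 + i) (by omega), hZ j _ (by omega) (by omega),
      hZ j _ (by omega) (by omega)⟩
  · intro j j' i i' hi hi' he
    have h1 := hadj1 j
    have h2 := htn j
    have h1' := hadj1 j'
    have h2' := htn j'
    obtain ⟨e1, e2⟩ := P.inj _ _ _ _ (by omega) (by omega) he
    obtain rfl := hh e1
    exact ⟨rfl, by omega⟩

open Classical in
/-- Large families of disjoint connected rows and of disjoint connected columns, each row meeting
each column, yield a wall minor. -/
lemma exists_hasMinor_wall {r : ℕ} (hr : 0 < r) : ∃ f : ℕ, 0 < f ∧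
    ∀ (V : Type) [Finite V] (Γ : SimpleGraph V) (R C : Fin f → Set V),
      (∀ i, Conn Γ (R i)) → (∀ s, Conn Γ (C s)) →
      (∀ i j, i ≠ j → Disjoint (R i) (R j)) → (∀ s t, s ≠ t → Disjoint (C s) (C t)) →
      (∀ i s, (R i ∩ C s).Nonempty) → HasMinor Γ (Wall r) := by
  let U := Fin r × Fin (2 * r)
  obtain ⟨K, hK⟩ := exists_linkage_bound hr (Fintype.card (U × U))
  set k := K + Fintype.card U * rowBound r with hk
  set b := k ^ rowBound r * colBound r k with hb
  set f := Fintype.card (U × U × U) * (b + 1) + 1 + k with hf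
  refine ⟨f, by omega, fun V _ Γ R C hR hC hRR hCC hRC => ?_⟩
  have hP : ∀ p q : Fin f, ∃ P : Linkage Γ.Adj (fun _ : Fin k => C p) (fun _ => C q),
      ∀ Q : Linkage Γ.Adj (fun _ : Fin k => C p) (fun _ => C q),
        (crossing C P).ncard ≤ (crossing C Q).ncard := by
    intro p q
    refine exists_crossing_minimal C ?_
    have hle : k ≤ f := by omega
    exact exists_linkage_of_rows (fun i => R (Fin.castLE hle i)) (fun i => hR _)
      (fun i j hij => hRR _ _ fun h => hij (Fin.castLE_injective hle h)) (fun i => hRC _ _)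
      fun i => hRC _ _
  choose P hmin using hP
  let F : Fin f → Fin f → Finset (Fin f) := fun p q =>
    Finset.univ.filter fun s => rowBound r ≤ (hits (P p q) (C s)).card
  by_cases hbig : ∃ p q, b < (F p q).card
  · obtain ⟨p, q, hpq⟩ := hbig
    refine hasMinor_wall_of_many_hits (I := Unit) hr C hC hCC (fun _ => P p q)
      (fun _ => hmin p q) (F p q) (by simpa [hb] using hpq)
      fun s hs => ⟨(), (Finset.mem_filter.1 hs).2⟩
  push Not at hbig
  obtain ⟨g, hg⟩ := exists_avoiding (U := U) (T := U × U × U) (b := b + 1) (f := f)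
    (fun t => t.2.2)
    (fun t g => if t.2.2 = t.1 ∨ t.2.2 = t.2.1 then ∅ else insert (g t.1) (F (g t.1) (g t.2.1)))
    (by
      rintro ⟨a, a', c⟩ g y
      by_cases h : c = a ∨ c = a'
      · simp [h]
      · push Not at h
        simp [h.1, h.2, Function.update_of_ne h.1.symm, Function.update_of_ne h.2.symm])
    (by
      rintro ⟨a, a', c⟩ g
      dsimp only
      split_ifs
      · simp
      · exact (Finset.card_insert_le _ _).trans (Nat.succ_le_succ (hbig _ _)))
    (by omega)
  have hgF : ∀ a a' c, c ≠ a → c ≠ a' → g c ≠ g a ∧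
      (hits (P (g a) (g a')) (C (g c))).card ≤ rowBound r := by
    intro a a' c h h'
    have := hg (a, a', c)
    simp only [h, h', or_self, if_false, Finset.mem_insert, not_or] at this
    refine ⟨this.1, ?_⟩
    have h2 := this.2
    simp only [F, Finset.mem_filter, Finset.mem_univ, true_and, not_le] at h2
    exact h2.le
  have hginj : ∀ a c, c ≠ a → g c ≠ g a := fun a c h => (hgF a a c h h).1
  let β : U → Set V := fun a => C (g a)
  have hβ : ∀ a a', a ≠ a' → Disjoint (β a) (β a') := fun a a' h => hCC _ _ (hginj _ _ h)
  let I := {e : U × U // e.1 ≠ e.2 ∧ ∀ x ∈ β e.1, ∀ y ∈ β e.2, ¬ Γ.Adj x y}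
  set Z : Set V := (⋃ c, β c)ᶜ with hZ
  rcases hK V I (edgesWithin Γ Z) (fun e => {z | z ∈ Z ∧ ∃ x ∈ β e.1.1, Γ.Adj x z})
      (fun e => {z | z ∈ Z ∧ ∃ x ∈ β e.1.2, Γ.Adj z x}) (Fintype.card_subtype_le _)
      (fun e => exists_linkage_outside β (hβ _ _ e.2.1) e.2.2 (P _ _)
        (fun c h h' => (hgF _ _ c h h').2) le_rfl) with hw | ⟨⟨Q⟩⟩
  · exact hw.mono (edgesWithin_le _ _)
  have hQZ := Q.mem_of_within fun _ z hz => hz.1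
  let M : U → U → Set V := fun a a' => {z | ∃ h : _, ∃ i ≤ Q.n ⟨(a, a'), h⟩, z = Q.p ⟨(a, a'), h⟩ i}
  have hMZ : ∀ a a', M a a' ⊆ Z := by
    rintro a a' _ ⟨h, i, hi, rfl⟩
    exact hQZ _ i hi
  have hM : ∀ a a' (h : a ≠ a' ∧ ∀ x ∈ β a, ∀ y ∈ β a', ¬ Γ.Adj x y),
      M a a' = Q.p ⟨(a, a'), h⟩ '' Set.Ico 0 (Q.n ⟨(a, a'), h⟩ + 1) := by
    intro a a' h
    ext z
    constructor
    · rintro ⟨_, i, hi, rfl⟩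
      exact ⟨i, ⟨Nat.zero_le _, by omega⟩, rfl⟩
    · rintro ⟨i, hi, rfl⟩
      exact ⟨h, i, Nat.lt_succ_iff.1 hi.2, rfl⟩
  refine HasMinor.of_hubs β (fun a a' => a ≠ a') M (fun a => hC _) hβ (fun u v h => .inl h.ne)
    ?_ ?_ ?_ ?_
  · intro a a' hne
    by_cases h : ∀ x ∈ β a, ∀ y ∈ β a', ¬ Γ.Adj x y
    · rw [hM a a' ⟨hne, h⟩]
      refine (hC _).union ((Q.conn _).mono_graph (edgesWithin_le _ _)) ?_
      obtain ⟨-, x, hx, hxz⟩ := Q.start ⟨(a, a'), hne, h⟩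
      exact ⟨x, hx, _, ⟨0, by simp, rfl⟩, .inr hxz⟩
    · have : M a a' = ∅ := by
        ext z
        refine ⟨?_, fun hz => hz.elim⟩
        rintro ⟨h', -⟩
        exact h h'.2
      rw [this, Set.union_empty]
      exact hC _
  · intro a a' hne
    by_cases h : ∀ x ∈ β a, ∀ y ∈ β a', ¬ Γ.Adj x y
    · obtain ⟨-, y, hy, hzy⟩ := Q.finish ⟨(a, a'), hne, h⟩
      exact ⟨_, .inr ⟨⟨hne, h⟩, _, le_rfl, rfl⟩, y, hy, hzy⟩
    · push Not at h
      obtain ⟨x, hx, y, hy, hxy⟩ := h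
      exact ⟨x, .inl hx, y, hy, hxy⟩
  · intro a a' c _ _
    exact Set.disjoint_left.2 fun z hz hc => hMZ _ _ hz (Set.mem_iUnion.2 ⟨c, hc⟩)
  · intro a a' c c' _ _ hne
    refine Set.disjoint_left.2 ?_
    rintro _ ⟨h, i, hi, rfl⟩ ⟨h', i', hi', he⟩
    have := (Q.inj _ _ _ _ hi hi' he).1
    exact hne (congrArg (fun e : I => e.1.1) this)

lemma Conn.reach_of_subset {V : Type} {Γ : SimpleGraph V} {s t : Set V} (hs : Conn Γ s)
    (hst : s ⊆ t) {a b : V} (ha : a ∈ s) (hb : b ∈ s) : Relation.ReflTransGen (AdjIn Γ t) a b :=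
  AdjIn.reach_mono hst (hs.2 a ha b hb)

/-- Suppose that connected, pairwise anticomplete sets `σ s`, each attached to exactly two of the
connected, pairwise anticomplete sets `D k`, realise the edges of `Γ`. Then every minor of `Γ` is an
induced minor of `G`. -/
lemma hasInducedMinor_of_hasMinor {V K S W : Type} {G : SimpleGraph V} {Γ : SimpleGraph K}
    {H : SimpleGraph W} (D : K → Set V) (σ : S → Set V) (e₁ e₂ : S → K)
    (hD : ∀ k, Conn G (D k)) (hDD : ∀ k k', k ≠ k' → Anticomplete G (D k) (D k'))
    (hσ : ∀ s, Conn G (σ s)) (hσσ : ∀ s s', s ≠ s' → Anticomplete G (σ s) (σ s'))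
    (hσD : ∀ s k, Disjoint (σ s) (D k))
    (h₁ : ∀ s, ∃ x ∈ σ s, ∃ y ∈ D (e₁ s), G.Adj x y)
    (h₂ : ∀ s, ∃ x ∈ σ s, ∃ y ∈ D (e₂ s), G.Adj x y)
    (hends : ∀ s k, ∀ x ∈ σ s, ∀ y ∈ D k, G.Adj x y → k = e₁ s ∨ k = e₂ s)
    (hΓ : ∀ k k', Γ.Adj k k' → ∃ s, e₁ s = k ∧ e₂ s = k' ∨ e₁ s = k' ∧ e₂ s = k)
    (hm : HasMinor Γ H) : HasInducedMinor G H := by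
  obtain ⟨β, hβ, hβd, hβa⟩ := hm
  have huniq : ∀ k u v, k ∈ β u → k ∈ β v → u = v := by
    intro k u v hu hv
    by_contra hne
    exact Set.disjoint_left.1 (hβd u v hne) hu hv
  let own : W → S → Prop := fun u s => e₁ s ∈ β u ∧ ∃ v, e₂ s ∈ β v ∧ (v = u ∨ H.Adj u v)
  let B : W → Set V := fun u => {x | (∃ k ∈ β u, x ∈ D k) ∨ ∃ s, own u s ∧ x ∈ σ s}
  have hDB : ∀ u, ∀ k ∈ β u, D k ⊆ B u := fun u k hk x hx => .inl ⟨k, hk, hx⟩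
  have hσB : ∀ u s, own u s → σ s ⊆ B u := fun u s hs x hx => .inr ⟨s, hs, hx⟩
  have hstep : ∀ u s, own u s → ∀ x ∈ σ s, ∀ k, (k = e₁ s ∨ k = e₂ s) → k ∈ β u → ∀ y ∈ D k,
      Relation.ReflTransGen (AdjIn G (B u)) x y := by
    intro u s hs x hx k hk hku y hy
    have : ∃ x ∈ σ s, ∃ y ∈ D k, G.Adj x y := by
      rcases hk with rfl | rfl
      · exact h₁ s
      · exact h₂ s
    obtain ⟨a, ha, b, hb, hab⟩ := this
    refine ((hσ s).reach_of_subset (hσB u s hs) hx ha).trans (Relation.ReflTransGen.head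
      ⟨hab, hσB u s hs ha, hDB u k hku hb⟩ ((hD k).reach_of_subset (hDB u k hku) hb hy))
  have hreach : ∀ u k k', k ∈ β u → Relation.ReflTransGen (AdjIn Γ (β u)) k k' →
      ∀ x ∈ D k, ∀ y ∈ D k', Relation.ReflTransGen (AdjIn G (B u)) x y := by
    intro u k k' hk hkk' x hx
    induction hkk' with
    | refl => exact fun y hy => (hD k).reach_of_subset (hDB u k hk) hx hy
    | @tail c d _ hcd ih =>
      intro y hy
      obtain ⟨z, hz⟩ := (hD c).1
      obtain ⟨hadj, hc, hd⟩ := hcd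
      obtain ⟨s, hs⟩ := hΓ c d hadj
      have hown : own u s := by
        rcases hs with ⟨rfl, rfl⟩ | ⟨rfl, rfl⟩
        · exact ⟨hc, u, hd, .inl rfl⟩
        · exact ⟨hd, u, hc, .inl rfl⟩
      obtain ⟨w, hw⟩ := (hσ s).1
      exact (ih z hz).trans ((AdjIn.reach_symm (hstep u s hown w hw c
        (by rcases hs with ⟨rfl, rfl⟩ | ⟨rfl, rfl⟩ <;> simp) hc z hz)).trans
        (hstep u s hown w hw d
          (by rcases hs with ⟨rfl, rfl⟩ | ⟨rfl, rfl⟩ <;> simp) hd y hy))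
  have hBconn : ∀ u, Conn G (B u) := by
    intro u
    obtain ⟨k₀, hk₀⟩ := (hβ u).1
    obtain ⟨c, hc⟩ := (hD k₀).1
    have hto : ∀ a ∈ B u, Relation.ReflTransGen (AdjIn G (B u)) a c := by
      rintro a (⟨k, hk, ha⟩ | ⟨s, hs, ha⟩)
      · exact hreach u k k₀ hk ((hβ u).2 k hk k₀ hk₀) a ha c hc
      · obtain ⟨z, hz⟩ := (hD (e₁ s)).1
        exact (hstep u s hs a ha _ (.inl rfl) hs.1 z hz).trans
          (hreach u _ k₀ hs.1 ((hβ u).2 _ hs.1 k₀ hk₀) z hz c hc)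
    exact ⟨⟨c, hDB u k₀ hk₀ hc⟩, fun a ha b hb => (hto a ha).trans (AdjIn.reach_symm (hto b hb))⟩
  have hBdisj : ∀ u v, u ≠ v → Disjoint (B u) (B v) := by
    intro u v huv
    rw [Set.disjoint_left]
    rintro x (⟨k, hk, hx⟩ | ⟨s, hs, hx⟩) (⟨k', hk', hx'⟩ | ⟨s', hs', hx'⟩)
    · by_cases h : k = k'
      · exact huv (huniq k u v hk (h ▸ hk'))
      · exact Set.disjoint_left.1 (hDD k k' h).1 hx hx'
    · exact Set.disjoint_left.1 (hσD s' k) hx' hx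
    · exact Set.disjoint_left.1 (hσD s k') hx hx'
    · by_cases h : s = s'
      · subst h
        exact huv (huniq _ u v hs.1 hs'.1)
      · exact Set.disjoint_left.1 (hσσ s s' h).1 hx hx'
  refine ⟨B, fun u => conn_iff_induce_connected.1 (hBconn u), fun u v => hBdisj u v,
    fun u v huv => ⟨fun hadj hanti => ?_, fun hanti => ?_⟩⟩
  · have key : ∀ u v, H.Adj u v → ∀ s, e₁ s ∈ β u → e₂ s ∈ β v →
        ∃ x ∈ B u, ∃ y ∈ B v, G.Adj x y := by
      intro u v h s h1 h2
      obtain ⟨x, hx, y, hy, hxy⟩ := h₂ s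
      exact ⟨x, hσB u s ⟨h1, v, h2, .inr h⟩ hx, y, hDB v _ h2 hy, hxy⟩
    obtain ⟨k, hk, k', hk', hkk'⟩ := hβa u v hadj
    obtain ⟨s, ⟨rfl, rfl⟩ | ⟨rfl, rfl⟩⟩ := hΓ k k' hkk'
    · obtain ⟨x, hx, y, hy, hxy⟩ := key u v hadj s hk hk'
      exact hanti.2 x hx y hy hxy
    · obtain ⟨x, hx, y, hy, hxy⟩ := key v u hadj.symm s hk' hk
      exact hanti.2 y hy x hx hxy.symm
  · by_contra hnadj
    have key : ∀ u v, u ≠ v → ¬ H.Adj u v → ∀ k ∈ β u, ∀ x ∈ D k, ∀ s, own v s → ∀ y ∈ σ s,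
        ¬ G.Adj y x := by
      rintro u v huv hnadj k hk x hx s ⟨hs1, w, hw, hvw⟩ y hy hyx
      rcases hends s k y hy x hx hyx with rfl | rfl
      · exact huv (huniq _ u v hk hs1)
      · obtain rfl := huniq _ u w hk hw
        rcases hvw with h | h
        · exact huv h
        · exact hnadj h.symm
    refine hanti ⟨hBdisj u v huv, ?_⟩
    rintro x (⟨k, hk, hx⟩ | ⟨s, hs, hx⟩) y (⟨k', hk', hy⟩ | ⟨s', hs', hy⟩) hxy
    · refine (hDD k k' ?_).2 x hx y hy hxy
      rintro rfl
      exact huv (huniq k u v hk hk')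
    · exact key u v huv hnadj k hk x hx s' hs' y hy hxy.symm
    · exact key v u huv.symm (fun h => hnadj h.symm) k' hk' y hy s hs x hx hxy
    · refine (hσσ s s' ?_).2 x hx y hy hxy
      rintro rfl
      exact huv (huniq _ u v hs.1 hs'.1)

/-- The connected components of the subgraph of `G` induced on `N`. -/
def Node {V : Type} (G : SimpleGraph V) (N : Set V) : Type :=
  Quot fun u v : N => G.Adj u v

section Node

variable {V : Type} {G : SimpleGraph V} {N : Set V}

instance [Finite V] : Finite (Node G N) := inferInstanceAs (Finite (Quot _))

/-- The component containing a given vertex. -/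
def Node.mk (v : V) (h : v ∈ N) : Node G N := Quot.mk _ ⟨v, h⟩

/-- The vertex set of a component. -/
def Node.verts (k : Node G N) : Set V := {v | ∃ h : v ∈ N, Node.mk v h = k}

lemma Node.mk_eq_of_adj {u v : V} (hu : u ∈ N) (hv : v ∈ N) (h : G.Adj u v) :
    (Node.mk u hu : Node G N) = Node.mk v hv :=
  Quot.sound h

lemma Node.exists_mk (k : Node G N) : ∃ v h, Node.mk v h = k := by
  obtain ⟨⟨v, h⟩, rfl⟩ := Quot.exists_rep k
  exact ⟨v, h, rfl⟩

lemma Node.reach {u v : V} (hu : u ∈ N) (hv : v ∈ N)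
    (h : (Node.mk u hu : Node G N) = Node.mk v hv) :
    Relation.ReflTransGen (AdjIn G (Node.mk u hu : Node G N).verts) u v := by
  have key : ∀ x y : N, Relation.EqvGen (fun u v : N => G.Adj u v) x y →
      Relation.ReflTransGen (AdjIn G (Node.mk x.1 x.2 : Node G N).verts) x y := by
    intro x y hxy
    induction hxy with
    | rel x y h => exact .single ⟨h, ⟨x.2, rfl⟩, ⟨y.2, (Node.mk_eq_of_adj x.2 y.2 h).symm⟩⟩
    | refl x => exact .refl
    | symm x y h ih =>
      have : (Node.mk x.1 x.2 : Node G N) = Node.mk y.1 y.2 := Quot.eqvGen_sound h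
      rw [← this]
      exact AdjIn.reach_symm ih
    | trans x y z h _ ih₁ ih₂ =>
      have : (Node.mk x.1 x.2 : Node G N) = Node.mk y.1 y.2 := Quot.eqvGen_sound h
      exact ih₁.trans (this ▸ ih₂)
  exact key ⟨u, hu⟩ ⟨v, hv⟩ (Quot.eqvGen_exact h)

lemma Node.conn_verts (k : Node G N) : Conn G k.verts := by
  obtain ⟨u, hu, rfl⟩ := k.exists_mk
  have hto : ∀ v ∈ (Node.mk u hu : Node G N).verts,
      Relation.ReflTransGen (AdjIn G (Node.mk u hu : Node G N).verts) u v := by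
    rintro v ⟨hv, h⟩
    exact Node.reach hu hv h.symm
  exact ⟨⟨u, hu, rfl⟩, fun a ha b hb => (AdjIn.reach_symm (hto a ha)).trans (hto b hb)⟩

lemma Node.anticomplete {k k' : Node G N} (hne : k ≠ k') : Anticomplete G k.verts k'.verts := by
  refine ⟨Set.disjoint_left.2 ?_, ?_⟩
  · rintro x ⟨hx, rfl⟩ ⟨_, rfl⟩
    exact hne rfl
  · rintro x ⟨hx, rfl⟩ y ⟨hy, rfl⟩ h
    exact hne (Node.mk_eq_of_adj hx hy h)

/-- A property that is preserved along edges within `N` is shared by the vertices of a node. -/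
lemma Node.propagate {T : Set V} (hT : ∀ u ∈ N, ∀ v ∈ N, G.Adj u v → u ∈ T → v ∈ T) {u v : V}
    (hu : u ∈ N) (hv : v ∈ N) (h : (Node.mk u hu : Node G N) = Node.mk v hv) (huT : u ∈ T) :
    v ∈ T := by
  have key : ∀ w, Relation.ReflTransGen (AdjIn G (Node.mk u hu : Node G N).verts) u w → w ∈ T := by
    intro w hw
    induction hw with
    | refl => exact huT
    | tail _ h ih =>
      obtain ⟨hadj, ⟨hb, _⟩, hc, _⟩ := h
      exact hT _ hb _ hc hadj ih
  exact key v (Node.reach hu hv h)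

end Node

/-- A family of pairwise disjoint induced paths `p t 0, …, p t (n t)` of `G`. -/
structure PathSystem {V : Type} (G : SimpleGraph V) (I : Type) where
  n : I → ℕ
  p : I → ℕ → V
  inj : ∀ t t' i i', i ≤ n t → i' ≤ n t' → p t i = p t' i' → t = t' ∧ i = i'
  adj : ∀ t i, i < n t → G.Adj (p t i) (p t (i + 1))
  induced : ∀ t i j, i ≤ n t → j ≤ n t → G.Adj (p t i) (p t j) → j = i + 1 ∨ i = j + 1

namespace PathSystem

variable {V I : Type} {G : SimpleGraph V} (P : PathSystem G I)

/-- The vertices on some path of the system that have a neighbour on another path. -/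
def contacts : Set V :=
  {v | ∃ t t' i i', t ≠ t' ∧ i ≤ P.n t ∧ i' ≤ P.n t' ∧ v = P.p t i ∧ G.Adj v (P.p t' i')}

lemma mem_contacts {t t' : I} {i i' : ℕ} (h : t ≠ t') (hi : i ≤ P.n t) (hi' : i' ≤ P.n t')
    (hadj : G.Adj (P.p t i) (P.p t' i')) : P.p t i ∈ P.contacts :=
  ⟨t, t', i, i', h, hi, hi', rfl, hadj⟩

/-- A segment: a path of the system together with two non-consecutive contacts on it that have no
contact in between. -/
def Segment : Type :=
  {s : I × ℕ × ℕ // s.2.1 + 1 < s.2.2 ∧ s.2.2 ≤ P.n s.1 ∧ P.p s.1 s.2.1 ∈ P.contacts ∧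
    P.p s.1 s.2.2 ∈ P.contacts ∧ ∀ i, s.2.1 < i → i < s.2.2 → P.p s.1 i ∉ P.contacts}

/-- The interior vertices of a segment. -/
def inner (s : P.Segment) : Set V := P.p s.1.1 '' Set.Ico (s.1.2.1 + 1) s.1.2.2

/-- The first end of a segment. -/
def fstNode (s : P.Segment) : Node G P.contacts := Node.mk _ s.2.2.2.1

/-- The second end of a segment. -/
def sndNode (s : P.Segment) : Node G P.contacts := Node.mk _ s.2.2.2.2.1

/-- The graph on the nodes whose edges are realised by the segments. -/
def nodeGraph : SimpleGraph (Node G P.contacts) where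
  Adj k k' := k ≠ k' ∧ ∃ s : P.Segment, P.fstNode s = k ∧ P.sndNode s = k' ∨
    P.fstNode s = k' ∧ P.sndNode s = k
  symm := ⟨fun _ _ ⟨h, s, hs⟩ => ⟨h.symm, s, hs.symm⟩⟩
  loopless := ⟨fun _ h => h.1 rfl⟩

/-- The nodes that meet a path of the system. -/
def nodesOn (t : I) : Set (Node G P.contacts) :=
  {k | ∃ i ≤ P.n t, ∃ h : P.p t i ∈ P.contacts, Node.mk _ h = k}

lemma inner_notMem {s : P.Segment} {v : V} (hv : v ∈ P.inner s) : v ∉ P.contacts := by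
  obtain ⟨i, ⟨h1, h2⟩, rfl⟩ := hv
  exact s.2.2.2.2.2 i h1 h2

lemma hasInducedMinor {W : Type} {H : SimpleGraph W} (h : HasMinor P.nodeGraph H) :
    HasInducedMinor G H := by
  refine hasInducedMinor_of_hasMinor Node.verts P.inner P.fstNode P.sndNode Node.conn_verts
    (fun k k' => Node.anticomplete) ?_ ?_ ?_ ?_ ?_ ?_ (fun k k' (h : P.nodeGraph.Adj k k') => h.2) h
  · rintro ⟨⟨t, x, y⟩, hxy, hy, -⟩
    exact Conn.image_interval hxy fun i _ hi => P.adj t i (by dsimp only at hi hy; omega)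
  · rintro ⟨⟨t, x, y⟩, hxy, hy, hxN, hyN, hN⟩ ⟨⟨t', x', y'⟩, hxy', hy', hxN', hyN', hN'⟩ hne
    dsimp only at hxy hy hxN hyN hN hxy' hy' hxN' hyN' hN'
    have key : ∀ i i', x < i → i < y → x' < i' → i' < y' → t = t' → i ≤ i' + 1 → i' ≤ i + 1 →
        False := by
      rintro i i' h1 h2 h3 h4 rfl h5 h6
      have a1 : ¬ (x' < x ∧ x < y') := fun h => hN' x h.1 h.2 hxN
      have a2 : ¬ (x' < y ∧ y < y') := fun h => hN' y h.1 h.2 hyN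
      have a3 : ¬ (x < x' ∧ x' < y) := fun h => hN x' h.1 h.2 hxN'
      have a4 : ¬ (x < y' ∧ y' < y) := fun h => hN y' h.1 h.2 hyN'
      obtain ⟨rfl, rfl⟩ : x = x' ∧ y = y' := by omega
      exact hne rfl
    refine ⟨Set.disjoint_left.2 ?_, ?_⟩
    · rintro _ ⟨i, ⟨h1, h2⟩, rfl⟩ ⟨i', ⟨h3, h4⟩, he⟩
      dsimp only at h1 h2 h3 h4 he
      obtain ⟨e1, e2⟩ := P.inj _ _ _ _ (by omega) (by omega) he
      exact key i i' h1 h2 h3 h4 e1.symm (by omega) (by omega)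
    · rintro _ ⟨i, ⟨h1, h2⟩, rfl⟩ _ ⟨i', ⟨h3, h4⟩, rfl⟩ hadj
      dsimp only at h1 h2 h3 h4 hadj
      by_cases htt : t = t'
      · subst htt
        have := P.induced t i i' (by omega) (by omega) hadj
        exact key i i' h1 h2 h3 h4 rfl (by omega) (by omega)
      · exact hN i h1 h2 (P.mem_contacts htt (by omega) (by omega) hadj)
  · exact fun s k => Set.disjoint_left.2 fun v hv ⟨hvN, _⟩ => P.inner_notMem hv hvN
  · rintro ⟨⟨t, x, y⟩, hxy, hy, hxN, hyN, hN⟩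
    exact ⟨_, ⟨x + 1, ⟨le_rfl, hxy⟩, rfl⟩, P.p t x, ⟨hxN, rfl⟩,
      (P.adj t x (by dsimp only at hxy hy; omega)).symm⟩
  · rintro ⟨⟨t, x, y⟩, hxy, hy, hxN, hyN, hN⟩
    dsimp only at hxy hy
    refine ⟨_, ⟨y - 1, ⟨by dsimp only; omega, by dsimp only; omega⟩, rfl⟩, P.p t y, ⟨hyN, rfl⟩, ?_⟩
    have := P.adj t (y - 1) (by omega)
    rwa [Nat.sub_add_cancel (by omega)] at this
  · rintro ⟨⟨t, x, y⟩, hxy, hy, hxN, hyN, hN⟩ k _ ⟨i, ⟨h1, h2⟩, rfl⟩ v ⟨hvN, rfl⟩ hadj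
    dsimp only at hxy hy h1 h2 hadj hN
    obtain ⟨t', -, j, -, -, hj, -, rfl, -⟩ := id hvN
    by_cases htt : t = t'
    · subst htt
      have hji := P.induced t i j (by omega) hj hadj
      have : ¬ (x < j ∧ j < y) := fun h => hN j h.1 h.2 hvN
      obtain rfl | rfl : j = x ∨ j = y := by omega
      · exact .inl rfl
      · exact .inr rfl
    · exact absurd (P.mem_contacts htt (by omega) hj hadj) (hN i h1 h2)

lemma conn_nodesOn {t : I} (hne : ∃ i ≤ P.n t, P.p t i ∈ P.contacts) :
    Conn P.nodeGraph (P.nodesOn t) := by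
  classical
  have key : ∀ j ≤ P.n t, ∀ i ≤ j, ∀ (hi : P.p t i ∈ P.contacts) (hj : P.p t j ∈ P.contacts),
      Relation.ReflTransGen (AdjIn P.nodeGraph (P.nodesOn t)) (Node.mk _ hi) (Node.mk _ hj) := by
    intro j
    induction j using Nat.strong_induction_on with
    | _ j ih =>
      intro hjn i hij hi hj
      obtain rfl | hlt := hij.eq_or_lt
      · exact .refl
      let m := Nat.findGreatest (fun l => P.p t l ∈ P.contacts) (j - 1)
      have hm : P.p t m ∈ P.contacts :=
        Nat.findGreatest_spec (P := fun l => P.p t l ∈ P.contacts) (by omega) hi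
      have him : i ≤ m := Nat.le_findGreatest (by omega) hi
      have hmj : m ≤ j - 1 := Nat.findGreatest_le _
      refine (ih m (by omega) (by omega) i him hi hm).trans ?_
      by_cases hmj' : m + 1 = j
      · have : (Node.mk _ hm : Node G P.contacts) = Node.mk _ hj :=
          Node.mk_eq_of_adj _ _ (by rw [← hmj']; exact P.adj t m (by omega))
        rw [this]
      · by_cases heq : (Node.mk _ hm : Node G P.contacts) = Node.mk _ hj
        · rw [heq]
        · refine .single ⟨⟨heq, ⟨(t, m, j), by dsimp only; omega, hjn, hm, hj, ?_⟩,
            .inl ⟨rfl, rfl⟩⟩, ⟨m, by omega, hm, rfl⟩, ⟨j, hjn, hj, rfl⟩⟩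
          exact fun l h1 h2 => Nat.findGreatest_is_greatest h1 (by dsimp only at h2; omega)
  obtain ⟨i, hi, h⟩ := hne
  refine ⟨⟨_, i, hi, h, rfl⟩, ?_⟩
  rintro _ ⟨i, hi, h, rfl⟩ _ ⟨j, hj, h', rfl⟩
  rcases le_total i j with hij | hij
  · exact key j hj i hij h h'
  · exact AdjIn.reach_symm (key i hi j hij h' h)

lemma nodesOn_inter_nonempty {t t' : I} {i i' : ℕ} (h : t ≠ t') (hi : i ≤ P.n t)
    (hi' : i' ≤ P.n t') (hadj : G.Adj (P.p t i) (P.p t' i')) :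
    (P.nodesOn t ∩ P.nodesOn t').Nonempty := by
  have h1 := P.mem_contacts h hi hi' hadj
  have h2 := P.mem_contacts h.symm hi' hi hadj.symm
  exact ⟨Node.mk _ h1, ⟨i, hi, h1, rfl⟩, i', hi', h2, (Node.mk_eq_of_adj h1 h2 hadj).symm⟩

end PathSystem

lemma IsPathSet.exists_enumeration {V : Type} {G : SimpleGraph V} {P : Set V}
    (h : IsPathSet G P) : ∃ (n : ℕ) (p : ℕ → V), (∀ v, v ∈ P ↔ ∃ i ≤ n, p i = v) ∧
      (∀ i j, i ≤ n → j ≤ n → p i = p j → i = j) ∧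
      ∀ i j, i ≤ n → j ≤ n → (G.Adj (p i) (p j) ↔ j = i + 1 ∨ i = j + 1) := by
  obtain ⟨n, ⟨φ⟩⟩ := h
  let q : ℕ → P := fun i => φ.symm (Fin.ofNat (n + 1) i)
  have hval : ∀ i ≤ n, (Fin.ofNat (n + 1) i).val = i := fun i hi =>
    Nat.mod_eq_of_lt (Nat.lt_succ_of_le hi)
  refine ⟨n, fun i => q i, fun v => ⟨fun hv => ?_, ?_⟩, fun i j hi hj he => ?_,
    fun i j hi hj => ?_⟩
  · refine ⟨φ ⟨v, hv⟩, Nat.lt_succ_iff.1 (φ ⟨v, hv⟩).2, ?_⟩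
    simp [q]
  · rintro ⟨i, -, rfl⟩
    exact (q i).2
  · have := φ.symm.injective (Subtype.ext he)
    rw [← hval i hi, ← hval j hj, this]
  · have : G.Adj (q i) (q j) ↔ (pathGraph (n + 1)).Adj (Fin.ofNat (n + 1) i) (Fin.ofNat (n + 1) j) :=
      φ.symm.map_adj_iff
    rw [this, pathGraph_adj, hval i hi, hval j hj]
    omega

section Ample

variable {V : Type} {G : SimpleGraph V} {s t : ℕ} {A : Fin s → Set V} {B : Fin t → Set V}

lemma ModelAAmple.eq_of_common (h : ModelAAmple G A B 2)
    (hA : ∀ i j : Fin s, i ≠ j → Anticomplete G (A i) (A j)) {b : V} (hb : ∃ j, b ∈ B j)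
    {i i' : Fin s} {a a' : V} (ha : a ∈ A i) (ha' : a' ∈ A i') (hab : G.Adj a b)
    (hab' : G.Adj a' b) : i = i' := by
  by_contra hne
  let w : (⋃ j, B j : Set V) := ⟨b, Set.mem_iUnion.2 hb⟩
  have e1 : (AContraction G A B).Adj (Sum.inl i) (Sum.inr w) := by
    simp only [AContraction, fromRel_adj]
    exact ⟨by simp, .inl ⟨a, ha, hab⟩⟩
  have e2 : (AContraction G A B).Adj (Sum.inr w) (Sum.inl i') := by
    simp only [AContraction, fromRel_adj]
    exact ⟨by simp, .inr ⟨a', ha', hab'⟩⟩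
  have hn : ¬ (AContraction G A B).Adj (Sum.inl i) (Sum.inl i') := by
    simp only [AContraction, fromRel_adj]
    rintro ⟨-, ⟨-, x, hx, y, hy, hxy⟩ | ⟨-, x, hx, y, hy, hxy⟩⟩
    · exact (hA i i' hne).2 x hx y hy hxy
    · exact (hA i i' hne).2 y hy x hx hxy.symm
  have := h (Walk.cons e1 (Walk.cons e2 Walk.nil)) ⟨by simpa using hne, by simp [hne],
    ?_, by simp, ⟨i, rfl⟩, ⟨i', rfl⟩, by simp⟩
  · simp at this
  · have hn' := fun h => hn (SimpleGraph.Adj.symm h)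
    have e1' := e1.symm
    have e2' := e2.symm
    intro u v hu hv huv
    simp only [Walk.support_cons, Walk.support_nil, List.mem_cons, List.not_mem_nil,
      or_false] at hu hv
    rcases hu with rfl | rfl | rfl <;> rcases hv with rfl | rfl | rfl <;>
      simp_all [Walk.toSubgraph]

lemma ModelAAmple.eq_of_edge (h : ModelAAmple G A B 2)
    (hA : ∀ i j : Fin s, i ≠ j → Anticomplete G (A i) (A j)) {b b' : V} (hb : ∃ j, b ∈ B j)
    (hb' : ∃ j, b' ∈ B j) (hbb : G.Adj b b') {i i' : Fin s} {a a' : V} (ha : a ∈ A i)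
    (ha' : a' ∈ A i') (hab : G.Adj a b) (hab' : G.Adj a' b') : i = i' := by
  by_contra hne
  let w : (⋃ j, B j : Set V) := ⟨b, Set.mem_iUnion.2 hb⟩
  let w' : (⋃ j, B j : Set V) := ⟨b', Set.mem_iUnion.2 hb'⟩
  have hww : w ≠ w' := fun he => hbb.ne (congrArg Subtype.val he)
  have e1 : (AContraction G A B).Adj (Sum.inl i) (Sum.inr w) := by
    simp only [AContraction, fromRel_adj]
    exact ⟨by simp, .inl ⟨a, ha, hab⟩⟩
  have e2 : (AContraction G A B).Adj (Sum.inr w) (Sum.inr w') := by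
    simp only [AContraction, fromRel_adj]
    exact ⟨by simpa using hww, .inl hbb⟩
  have e3 : (AContraction G A B).Adj (Sum.inr w') (Sum.inl i') := by
    simp only [AContraction, fromRel_adj]
    exact ⟨by simp, .inr ⟨a', ha', hab'⟩⟩
  have hn : ¬ (AContraction G A B).Adj (Sum.inl i) (Sum.inl i') := by
    simp only [AContraction, fromRel_adj]
    rintro ⟨-, ⟨-, x, hx, y, hy, hxy⟩ | ⟨-, x, hx, y, hy, hxy⟩⟩
    · exact (hA i i' hne).2 x hx y hy hxy
    · exact (hA i i' hne).2 y hy x hx hxy.symm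
  have hn1 : ¬ (AContraction G A B).Adj (Sum.inl i) (Sum.inr w') := by
    simp only [AContraction, fromRel_adj, or_false]
    rintro ⟨-, x, hx, hxb⟩
    exact hne (h.eq_of_common hA hb' hx ha' hxb hab')
  have hn2 : ¬ (AContraction G A B).Adj (Sum.inr w) (Sum.inl i') := by
    simp only [AContraction, fromRel_adj, false_or]
    rintro ⟨-, x, hx, hxb⟩
    exact hne (h.eq_of_common hA hb ha hx hab hxb)
  have := h (Walk.cons e1 (Walk.cons e2 (Walk.cons e3 Walk.nil)))
    ⟨by simpa using hne, by simp [hne, hww], ?_, by simp, ⟨i, rfl⟩, ⟨i', rfl⟩, by simp⟩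
  · simp at this
  · have hn' := fun h => hn (SimpleGraph.Adj.symm h)
    have hn1' := fun h => hn1 (SimpleGraph.Adj.symm h)
    have hn2' := fun h => hn2 (SimpleGraph.Adj.symm h)
    have e1' := e1.symm
    have e2' := e2.symm
    have e3' := e3.symm
    intro u v hu hv huv
    simp only [Walk.support_cons, Walk.support_nil, List.mem_cons, List.not_mem_nil,
      or_false] at hu hv
    rcases hu with rfl | rfl | rfl | rfl <;> rcases hv with rfl | rfl | rfl | rfl <;>
      simp_all [Walk.toSubgraph]

/-- In an ample model, the path `A i` near which a contact lies propagates along edges. -/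
lemma ModelAAmple.near_of_adj (h : ModelAAmple G A B 2)
    (hA : ∀ i j : Fin s, i ≠ j → Anticomplete G (A i) (A j)) {N : Set V}
    (hN : ∀ v ∈ N, (∃ j, v ∈ A j) ∨ ((∃ j, v ∈ B j) ∧ ∃ j, ∃ a ∈ A j, G.Adj a v)) {i : Fin s} :
    ∀ u ∈ N, ∀ v ∈ N, G.Adj u v → u ∈ {x | x ∈ A i ∨ ∃ a ∈ A i, G.Adj a x} →
      v ∈ {x | x ∈ A i ∨ ∃ a ∈ A i, G.Adj a x} := by
  have hAi : ∀ j, ∀ x ∈ A j, (x ∈ A i ∨ ∃ a ∈ A i, G.Adj a x) → x ∈ A i := by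
    rintro j x hx (h | ⟨a, ha, hax⟩)
    · exact h
    · by_cases hij : i = j
      · exact hij ▸ hx
      · exact absurd hax ((hA i j hij).2 a ha x hx)
  intro u hu v hv huv huT
  rcases hN u hu with ⟨j, huj⟩ | ⟨huB, -⟩
  · exact .inr ⟨u, hAi j u huj huT, huv⟩
  · rcases huT with hui | ⟨a, ha, hau⟩
    · exact .inr ⟨u, hui, huv⟩
    · rcases hN v hv with ⟨j, hvj⟩ | ⟨hvB, j, a', ha', hav⟩
      · obtain rfl := h.eq_of_common hA huB ha hvj hau huv.symm
        exact .inl hvj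
      · obtain rfl := h.eq_of_edge hA huB hvB huv ha ha' hau hav
        exact .inr ⟨a', ha', hav⟩

end Ample

lemma PathSystem.disjoint_nodesOn {V I : Type} {G : SimpleGraph V} (P : PathSystem G I) {s t : ℕ}
    {A : Fin s → Set V} {B : Fin t → Set V} (h : ModelAAmple G A B 2)
    (hA : ∀ i j : Fin s, i ≠ j → Anticomplete G (A i) (A j))
    (hN : ∀ v ∈ P.contacts, (∃ j, v ∈ A j) ∨ ((∃ j, v ∈ B j) ∧ ∃ j, ∃ a ∈ A j, G.Adj a v))
    {T T' : I} {i i' : Fin s} (hT : ∀ l ≤ P.n T, P.p T l ∈ A i)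
    (hT' : ∀ l ≤ P.n T', P.p T' l ∈ A i') (hne : i ≠ i') :
    Disjoint (P.nodesOn T) (P.nodesOn T') := by
  rw [Set.disjoint_left]
  rintro _ ⟨l, hl, hlN, rfl⟩ ⟨l', hl', hlN', he⟩
  rcases Node.propagate (h.near_of_adj hA hN (i := i)) hlN hlN' he.symm (.inl (hT l hl))
    with h1 | ⟨a, ha, hal⟩
  · exact Set.disjoint_left.1 (hA i i' hne).1 h1 (hT' l' hl')
  · exact (hA i i' hne).2 a ha _ (hT' l' hl') hal

/-- Theorem 7.5: for every positive `r` there is `f` such that every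
graph with a `2`-ample linear induced `(f,f)`-model has an induced minor isomorphic to
the `r`-by-`r` wall. -/
theorem stmt13 (r : ℕ) (hr : 0 < r) :
    ∃ f : ℕ, 0 < f ∧
      ∀ (V : Type) [Fintype V] (G : SimpleGraph V)
        (A B : Fin f → Set V),
        IsInducedModel G A B →
        (∀ i, IsPathSet G (A i)) → (∀ j, IsPathSet G (B j)) →
        ModelAmple G A B 2 →
        HasInducedMinor G (Wall r) := by
  obtain ⟨f, hf, hmain⟩ := exists_hasMinor_wall hr
  refine ⟨f, hf, fun V _ G A B hM hpA hpB hamp => ?_⟩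
  obtain ⟨-, -, hAA, hBB, hAB⟩ := hM
  choose nA pA hA hAinj hAadj using fun i => (hpA i).exists_enumeration
  choose nB pB hB hBinj hBadj using fun i => (hpB i).exists_enumeration
  have hAmem : ∀ i, ∀ l ≤ nA i, pA i l ∈ A i := fun i l hl => (hA i _).2 ⟨l, hl, rfl⟩
  have hBmem : ∀ i, ∀ l ≤ nB i, pB i l ∈ B i := fun i l hl => (hB i _).2 ⟨l, hl, rfl⟩
  have hABne : ∀ i j, ∀ x ∈ A i, ∀ y ∈ B j, x ≠ y := by
    rintro i j x hx y hy rfl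
    exact Set.disjoint_left.1 (hAB i j).1 hx hy
  let P : PathSystem G (Fin f ⊕ Fin f) :=
    { n := Sum.elim nA nB
      p := Sum.elim pA pB
      inj := by
        rintro (i | i) (j | j) l l' hl hl' he
        · by_cases hij : i = j
          · subst hij
            exact ⟨rfl, hAinj i l l' hl hl' he⟩
          · have he : pA i l = pA j l' := he
            exact absurd (he ▸ hAmem i l hl)
              (Set.disjoint_right.1 (hAA i j hij).1 (hAmem j l' hl'))
        · exact absurd he (hABne i j _ (hAmem i l hl) _ (hBmem j l' hl'))
        · exact absurd he.symm (hABne j i _ (hAmem j l' hl') _ (hBmem i l hl))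
        · by_cases hij : i = j
          · subst hij
            exact ⟨rfl, hBinj i l l' hl hl' he⟩
          · have he : pB i l = pB j l' := he
            exact absurd (he ▸ hBmem i l hl)
              (Set.disjoint_right.1 (hBB i j hij).1 (hBmem j l' hl'))
      adj := by
        rintro (i | i) l hl
        · exact (hAadj i l (l + 1) (Nat.le_of_lt hl) hl).2 (.inl rfl)
        · exact (hBadj i l (l + 1) (Nat.le_of_lt hl) hl).2 (.inl rfl)
      induced := by
        rintro (i | i) l l' hl hl' h
        · exact (hAadj i l l' hl hl').1 h
        · exact (hBadj i l l' hl hl').1 h }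
  have hNA : ∀ v ∈ P.contacts, (∃ j, v ∈ A j) ∨ ((∃ j, v ∈ B j) ∧ ∃ j, ∃ a ∈ A j, G.Adj a v) := by
    rintro _ ⟨i | i, j | j, l, l', hne, hl, hl', rfl, hadj⟩
    · exact .inl ⟨i, hAmem i l hl⟩
    · exact .inl ⟨i, hAmem i l hl⟩
    · exact .inr ⟨⟨i, hBmem i l hl⟩, j, _, hAmem j l' hl', hadj.symm⟩
    · exact absurd hadj ((hBB i j fun h => hne (congrArg _ h)).2 _ (hBmem i l hl) _
        (hBmem j l' hl'))
  have hNB : ∀ v ∈ P.contacts, (∃ j, v ∈ B j) ∨ ((∃ j, v ∈ A j) ∧ ∃ j, ∃ a ∈ B j, G.Adj a v) := by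
    rintro _ ⟨i | i, j | j, l, l', hne, hl, hl', rfl, hadj⟩
    · exact absurd hadj ((hAA i j fun h => hne (congrArg _ h)).2 _ (hAmem i l hl) _
        (hAmem j l' hl'))
    · exact .inr ⟨⟨i, hAmem i l hl⟩, j, _, hBmem j l' hl', hadj.symm⟩
    · exact .inl ⟨i, hBmem i l hl⟩
    · exact .inl ⟨i, hBmem i l hl⟩
  have hcon : ∀ i j, ∃ l ≤ nA i, ∃ l' ≤ nB j, G.Adj (pA i l) (pB j l') := by
    intro i j
    by_contra hcon
    refine (hAB i j).2 ⟨(hAB i j).1, fun x hx y hy hxy => hcon ?_⟩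
    obtain ⟨l, hl, rfl⟩ := (hA i x).1 hx
    obtain ⟨l', hl', rfl⟩ := (hB j y).1 hy
    exact ⟨l, hl, l', hl', hxy⟩
  refine P.hasInducedMinor (hmain _ P.nodeGraph (fun i => P.nodesOn (.inl i))
    (fun j => P.nodesOn (.inr j)) (fun i => P.conn_nodesOn ?_) (fun j => P.conn_nodesOn ?_)
    (fun i j hij => P.disjoint_nodesOn hamp.1 hAA hNA (hAmem i) (hAmem j) hij)
    (fun i j hij => P.disjoint_nodesOn hamp.2 hBB hNB (hBmem i) (hBmem j) hij) fun i j => ?_)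
  · obtain ⟨l, hl, l', hl', h⟩ := hcon i ⟨0, hf⟩
    exact ⟨l, hl, P.mem_contacts (t := .inl i) (t' := .inr ⟨0, hf⟩) Sum.inl_ne_inr hl hl' h⟩
  · obtain ⟨l, hl, l', hl', h⟩ := hcon ⟨0, hf⟩ j
    exact ⟨l', hl', P.mem_contacts (t := .inr j) (t' := .inl ⟨0, hf⟩) Sum.inr_ne_inl hl' hl h.symm⟩
  · obtain ⟨l, hl, l', hl', h⟩ := hcon i j
    exact P.nodesOn_inter_nonempty (t := .inl i) (t' := .inr j) Sum.inl_ne_inr hl hl' h
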